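/- Let ζ be an extremal number and ε > 0. Then the inequality |Q(ζ)| ≤ H(Q)^{−3−ε} has only finitely many solutions Q ∈ ℤ[T] that are irreducible of degree exactly three. -/

import Mathlib

open Polynomial

/-- Height of an integer polynomial: the maximum absolute value of its coefficients. -/
noncomputable def polyH (P : Polynomial ℤ) : ℝ :=
  (((P.support.sup fun i => (P.coeff i).natAbs) : ℕ) : ℝ)

/-- Evaluation of an integer polynomial at a real number. -/
noncomputable def pev (ζ : ℝ) (P : Polynomial ℤ) : ℝ := Polynomial.aeval ζ P

/-- Set of exponents η such that for arbitrarily large X the system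
    H(P) ≤ X, 0 < |P(ζ)| ≤ X^(−η) has a solution of degree at most n. -/
def wSet (n : ℕ) (ζ : ℝ) : Set ℝ :=
  {η | ∀ X₀ : ℝ, ∃ X : ℝ, X₀ ≤ X ∧ ∃ P : Polynomial ℤ,
    P.natDegree ≤ n ∧ polyH P ≤ X ∧ 0 < |pev ζ P| ∧ |pev ζ P| ≤ X ^ (-η)}

/-- The exponent w_n(ζ). -/
noncomputable def wExp (n : ℕ) (ζ : ℝ) : ℝ := sSup (wSet n ζ)

/-- Set of exponents η such that for all sufficiently large X the system
    H(P) ≤ X, 0 < |P(ζ)| ≤ X^(−η) has a solution of degree at most n. -/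
def whSet (n : ℕ) (ζ : ℝ) : Set ℝ :=
  {η | ∃ X₀ : ℝ, ∀ X : ℝ, X₀ ≤ X → ∃ P : Polynomial ℤ,
    P.natDegree ≤ n ∧ polyH P ≤ X ∧ 0 < |pev ζ P| ∧ |pev ζ P| ≤ X ^ (-η)}

/-- The uniform exponent ŵ_n(ζ). -/
noncomputable def whExp (n : ℕ) (ζ : ℝ) : ℝ := sSup (whSet n ζ)

/-- Set of exponents η such that for arbitrarily large X the system
    |x| ≤ X, max_{1≤i≤n} |ζ^i x − y_i| ≤ X^(−η) has a nonzero integer solution. -/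
def lamSet (n : ℕ) (ζ : ℝ) : Set ℝ :=
  {η | ∀ X₀ : ℝ, ∃ X : ℝ, X₀ ≤ X ∧ ∃ x : ℤ, ∃ y : Fin n → ℤ,
    (x ≠ 0 ∨ y ≠ 0) ∧ ((|x| : ℤ) : ℝ) ≤ X ∧
    ∀ i : Fin n, |ζ ^ ((i : ℕ) + 1) * (x : ℝ) - (y i : ℝ)| ≤ X ^ (-η)}

/-- The exponent λ_n(ζ). -/
noncomputable def lamExp (n : ℕ) (ζ : ℝ) : ℝ := sSup (lamSet n ζ)

/-- Set of exponents η such that for all sufficiently large X the system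
    |x| ≤ X, max_{1≤i≤n} |ζ^i x − y_i| ≤ X^(−η) has a nonzero integer solution. -/
def lamhSet (n : ℕ) (ζ : ℝ) : Set ℝ :=
  {η | ∃ X₀ : ℝ, ∀ X : ℝ, X₀ ≤ X → ∃ x : ℤ, ∃ y : Fin n → ℤ,
    (x ≠ 0 ∨ y ≠ 0) ∧ ((|x| : ℤ) : ℝ) ≤ X ∧
    ∀ i : Fin n, |ζ ^ ((i : ℕ) + 1) * (x : ℝ) - (y i : ℝ)| ≤ X ^ (-η)}

/-- The uniform exponent λ̂_n(ζ). -/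
noncomputable def lamhExp (n : ℕ) (ζ : ℝ) : ℝ := sSup (lamhSet n ζ)

/-- Set of exponents η such that for arbitrarily large X the polynomial system has
    at least j linearly independent solutions of degree at most n. -/
def wSetJ (n j : ℕ) (ζ : ℝ) : Set ℝ :=
  {η | ∀ X₀ : ℝ, ∃ X : ℝ, X₀ ≤ X ∧ ∃ P : Fin j → Polynomial ℤ,
    LinearIndependent ℤ P ∧ ∀ i : Fin j,
      (P i).natDegree ≤ n ∧ polyH (P i) ≤ X ∧ 0 < |pev ζ (P i)| ∧ |pev ζ (P i)| ≤ X ^ (-η)}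

/-- The exponent w_{n,j}(ζ). -/
noncomputable def wExpJ (n j : ℕ) (ζ : ℝ) : ℝ := sSup (wSetJ n j ζ)

/-- Set of exponents η such that for all sufficiently large X the polynomial system has
    at least j linearly independent solutions of degree at most n. -/
def whSetJ (n j : ℕ) (ζ : ℝ) : Set ℝ :=
  {η | ∃ X₀ : ℝ, ∀ X : ℝ, X₀ ≤ X → ∃ P : Fin j → Polynomial ℤ,
    LinearIndependent ℤ P ∧ ∀ i : Fin j,
      (P i).natDegree ≤ n ∧ polyH (P i) ≤ X ∧ 0 < |pev ζ (P i)| ∧ |pev ζ (P i)| ≤ X ^ (-η)}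

/-- The uniform exponent ŵ_{n,j}(ζ). -/
noncomputable def whExpJ (n j : ℕ) (ζ : ℝ) : ℝ := sSup (whSetJ n j ζ)

/-- Set of exponents η such that for arbitrarily large X the simultaneous approximation
    system has at least j linearly independent integer vector solutions. -/
def lamSetJ (n j : ℕ) (ζ : ℝ) : Set ℝ :=
  {η | ∀ X₀ : ℝ, ∃ X : ℝ, X₀ ≤ X ∧ ∃ v : Fin j → (Fin (n + 1) → ℤ),
    LinearIndependent ℤ v ∧ ∀ i : Fin j,
      ((|v i 0| : ℤ) : ℝ) ≤ X ∧
      ∀ t : Fin n, |ζ ^ ((t : ℕ) + 1) * ((v i 0 : ℤ) : ℝ) - ((v i t.succ : ℤ) : ℝ)| ≤ X ^ (-η)}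

/-- The exponent λ_{n,j}(ζ). -/
noncomputable def lamExpJ (n j : ℕ) (ζ : ℝ) : ℝ := sSup (lamSetJ n j ζ)

/-- Set of exponents η such that for all sufficiently large X the simultaneous approximation
    system has at least j linearly independent integer vector solutions. -/
def lamhSetJ (n j : ℕ) (ζ : ℝ) : Set ℝ :=
  {η | ∃ X₀ : ℝ, ∀ X : ℝ, X₀ ≤ X → ∃ v : Fin j → (Fin (n + 1) → ℤ),
    LinearIndependent ℤ v ∧ ∀ i : Fin j,
      ((|v i 0| : ℤ) : ℝ) ≤ X ∧
      ∀ t : Fin n, |ζ ^ ((t : ℕ) + 1) * ((v i 0 : ℤ) : ℝ) - ((v i t.succ : ℤ) : ℝ)| ≤ X ^ (-η)}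

/-- The uniform exponent λ̂_{n,j}(ζ). -/
noncomputable def lamhExpJ (n j : ℕ) (ζ : ℝ) : ℝ := sSup (lamhSetJ n j ζ)

/-- An extremal number: a real transcendental number with ŵ₂(ζ) = (3+√5)/2. -/
def IsExtremal (ζ : ℝ) : Prop :=
  Transcendental ℚ ζ ∧ whExp 2 ζ = (3 + Real.sqrt 5) / 2

/-- The value at `ζ` of the quadratic polynomial with coefficient vector `P`. -/
def quadVal (ζ : ℝ) (P : Fin 3 → ℤ) : ℝ := P 0 + P 1 * ζ + P 2 * ζ ^ 2

/-- The cross product of two integer vectors. -/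
def crossVec (P Q : Fin 3 → ℤ) : Fin 3 → ℤ :=
  ![P 1 * Q 2 - P 2 * Q 1, P 2 * Q 0 - P 0 * Q 2, P 0 * Q 1 - P 1 * Q 0]

/-- The standard bilinear form on integer vectors. -/
def dotVec (P x : Fin 3 → ℤ) : ℤ := P 0 * x 0 + P 1 * x 1 + P 2 * x 2

/-- The determinant of the symmetric matrix with entries `x 0`, `x 1`, `x 1`, `x 2`. -/
def symDet (x : Fin 3 → ℤ) : ℤ := x 0 * x 2 - x 1 ^ 2

/-- The coefficients of `x` are bounded by `B` in absolute value. -/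
def HtLe (x : Fin 3 → ℤ) (B : ℝ) : Prop := ∀ i, |(x i : ℝ)| ≤ B

/-- `x` is within `E` of the line spanned by `(1, ζ, ζ ^ 2)`. -/
def ErrLe (ζ : ℝ) (x : Fin 3 → ℤ) (E : ℝ) : Prop :=
  |ζ * x 0 - x 1| ≤ E ∧ |ζ * x 1 - x 2| ≤ E

section Vectors

variable {ζ : ℝ} {P Q W x y : Fin 3 → ℤ} {A B E L M : ℝ}

theorem HtLe.mono (h : HtLe x A) (hAB : A ≤ B) : HtLe x B := fun i => (h i).trans hAB

theorem ErrLe.mono (h : ErrLe ζ x A) (hAB : A ≤ B) : ErrLe ζ x B :=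
  ⟨h.1.trans hAB, h.2.trans hAB⟩

theorem HtLe.nonneg (h : HtLe x A) : 0 ≤ A := (abs_nonneg _).trans (h 0)

theorem ErrLe.nonneg (h : ErrLe ζ x A) : 0 ≤ A := (abs_nonneg _).trans h.1

theorem abs_mul_sub_mul_le {a b c d A B C D : ℝ} (ha : |a| ≤ A) (hb : |b| ≤ B) (hc : |c| ≤ C)
    (hd : |d| ≤ D) : |a * b - c * d| ≤ A * B + C * D := by
  refine (abs_sub _ _).trans ?_
  rw [abs_mul, abs_mul]
  have := (abs_nonneg _).trans ha
  have := (abs_nonneg _).trans hc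
  gcongr

theorem htLe_crossVec (hP : HtLe P A) (hQ : HtLe Q B) : HtLe (crossVec P Q) (2 * (A * B)) := by
  intro i
  rw [two_mul]
  fin_cases i <;> simp only [crossVec, Fin.zero_eta, Fin.mk_one, Fin.reduceFinMk,
    Matrix.cons_val] <;> push_cast <;>
    exact abs_mul_sub_mul_le (hP _) (hQ _) (hP _) (hQ _)

theorem errLe_crossVec (hP : HtLe P A) (hQ : HtLe Q B) (hL : |quadVal ζ P| ≤ L)
    (hM : |quadVal ζ Q| ≤ M) : ErrLe ζ (crossVec P Q) ((1 + |ζ|) * (B * L + A * M)) := by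
  have h1 : |(Q 2 : ℝ) * quadVal ζ P - P 2 * quadVal ζ Q| ≤ B * L + A * M :=
    abs_mul_sub_mul_le (hQ _) hL (hP _) hM
  have h2 : |(Q 1 : ℝ) * quadVal ζ P - P 1 * quadVal ζ Q| ≤ B * L + A * M :=
    abs_mul_sub_mul_le (hQ _) hL (hP _) hM
  have h0 := (abs_nonneg _).trans h1
  constructor
  · have : ζ * (crossVec P Q 0 : ℝ) - (crossVec P Q 1 : ℝ)
        = (Q 2 : ℝ) * quadVal ζ P - P 2 * quadVal ζ Q := by
      simp only [crossVec, quadVal, Matrix.cons_val]; push_cast; ring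
    rw [this]
    nlinarith [abs_nonneg ζ]
  · have : ζ * (crossVec P Q 1 : ℝ) - (crossVec P Q 2 : ℝ)
        = -((Q 1 : ℝ) * quadVal ζ P - P 1 * quadVal ζ Q)
          - ζ * ((Q 2 : ℝ) * quadVal ζ P - P 2 * quadVal ζ Q) := by
      simp only [crossVec, quadVal, Matrix.cons_val]; push_cast; ring
    rw [this]
    refine (abs_sub _ _).trans ?_
    rw [abs_neg, abs_mul]
    nlinarith [mul_le_mul_of_nonneg_left h1 (abs_nonneg ζ)]

theorem crossVec_eq_zero_iff : crossVec x y = 0 ↔ ∀ i j, x i * y j = x j * y i := by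
  constructor
  · intro h i j
    have h0 : x 1 * y 2 - x 2 * y 1 = 0 := congrFun h 0
    have h1 : x 2 * y 0 - x 0 * y 2 = 0 := congrFun h 1
    have h2 : x 0 * y 1 - x 1 * y 0 = 0 := congrFun h 2
    fin_cases i <;> fin_cases j <;> simp <;> linarith
  · intro h
    ext i
    fin_cases i <;> simp [crossVec]
    · linarith [h 1 2]
    · linarith [h 2 0]
    · linarith [h 0 1]

theorem exists_ne_zero_of_ne_zero (hx : x ≠ 0) : ∃ i, x i ≠ 0 := Function.ne_iff.mp hx

theorem crossVec_parallel_trans (hy : y ≠ 0) (h1 : crossVec x y = 0) (h2 : crossVec y W = 0) :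
    crossVec x W = 0 := by
  rw [crossVec_eq_zero_iff] at *
  obtain ⟨k, hk⟩ := exists_ne_zero_of_ne_zero hy
  intro i j
  apply mul_right_cancel₀ (mul_ne_zero hk hk)
  calc x i * W j * (y k * y k) = (x i * y k) * (y k * W j) := by ring
    _ = (x k * y i) * (y j * W k) := by rw [h1 i k, h2 k j]
    _ = (x k * y j) * (y i * W k) := by ring
    _ = (x j * y k) * (y k * W i) := by rw [h1 k j, h2 i k]
    _ = _ := by ring

theorem crossVec_parallel_symm (h : crossVec x y = 0) : crossVec y x = 0 := by
  rw [crossVec_eq_zero_iff] at *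
  intro i j
  linarith [h j i]

/-- Two vectors orthogonal to `x` have a cross product parallel to `x`. -/
theorem crossVec_crossVec_of_dotVec (hP : dotVec P x = 0) (hQ : dotVec Q x = 0) :
    crossVec (crossVec P Q) x = 0 := by
  simp only [dotVec] at hP hQ
  ext i
  fin_cases i <;> simp [crossVec]
  · linear_combination Q 0 * hP - P 0 * hQ
  · linear_combination Q 1 * hP - P 1 * hQ
  · linear_combination Q 2 * hP - P 2 * hQ

theorem dotVec_crossVec_left : dotVec P (crossVec P Q) = 0 := by
  simp [dotVec, crossVec]; ring

theorem dotVec_crossVec_right : dotVec Q (crossVec P Q) = 0 := by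
  simp [dotVec, crossVec]; ring

theorem dotVec_eq_zero_of_parallel (hy : x ≠ 0) (h : crossVec x y = 0) (hP : dotVec P x = 0) :
    dotVec P y = 0 := by
  rw [crossVec_eq_zero_iff] at h
  obtain ⟨k, hk⟩ := exists_ne_zero_of_ne_zero hy
  apply mul_left_cancel₀ hk
  simp only [dotVec] at *
  linear_combination P 0 * h k 0 + P 1 * h k 1 + P 2 * h k 2 + y k * hP

theorem symDet_ne_zero_of_parallel (hy : y ≠ 0) (h : crossVec x y = 0) (hx : symDet x ≠ 0) :
    symDet y ≠ 0 := by
  rw [crossVec_eq_zero_iff] at h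
  obtain ⟨k, hk⟩ := exists_ne_zero_of_ne_zero hy
  intro h0
  apply hx
  apply mul_left_cancel₀ (mul_ne_zero hk hk)
  simp only [symDet] at *
  have e0 := h k 0
  have e1 := h k 1
  have e2 := h k 2
  have : x 0 * y k * (x 2 * y k) - (x 1 * y k) ^ 2 = 0 := by
    rw [← e0, ← e1, ← e2]; linear_combination x k ^ 2 * h0
  linear_combination this

theorem symDet_le (hx : HtLe x B) (he : ErrLe ζ x E) : |(symDet x : ℝ)| ≤ 2 * (B * E) := by
  have : (symDet x : ℝ) = x 1 * (ζ * x 0 - x 1) - x 0 * (ζ * x 1 - x 2) := by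
    simp only [symDet]; push_cast; ring
  rw [this, two_mul]
  exact abs_mul_sub_mul_le (hx _) he.1 (hx _) he.2

theorem one_le_abs_intCast {n : ℤ} (hn : n ≠ 0) : (1 : ℝ) ≤ |(n : ℝ)| := by
  exact_mod_cast Int.one_le_abs hn

theorem one_le_of_parallel (hx : HtLe x B) (he : ErrLe ζ y E) (hpar : crossVec x y = 0)
    (hdet : symDet x ≠ 0) (hy : y ≠ 0) : 1 ≤ 2 * (B * E) := by
  rw [crossVec_eq_zero_iff] at hpar
  have hN : x 0 * y 2 - x 1 * y 1 ≠ 0 := by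
    intro hN
    obtain ⟨k, hk⟩ := exists_ne_zero_of_ne_zero hy
    apply mul_ne_zero hk hdet
    have key : ∀ k, y k * symDet x = x k * (x 0 * y 2 - x 1 * y 1) := by
      intro k
      simp only [symDet]
      fin_cases k <;> simp
      · linear_combination -(x 0) * hpar 0 2 + x 1 * hpar 0 1
      · linear_combination -(x 0) * hpar 1 2
      · linear_combination -(x 1) * hpar 1 2
    rw [key, hN, mul_zero]
  refine (one_le_abs_intCast hN).trans ?_
  have h01 : (x 0 : ℝ) * y 1 = x 1 * y 0 := by exact_mod_cast hpar 0 1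
  have : ((x 0 * y 2 - x 1 * y 1 : ℤ) : ℝ)
      = x 1 * (ζ * y 0 - y 1) - x 0 * (ζ * y 1 - y 2) := by
    push_cast; linear_combination ζ * h01
  rw [this, two_mul]
  exact abs_mul_sub_mul_le (hx _) he.1 (hx _) he.2

theorem one_le_symDet (hx : HtLe x B) (he : ErrLe ζ x E) (hdet : symDet x ≠ 0) :
    1 ≤ 2 * (B * E) :=
  (one_le_abs_intCast hdet).trans (symDet_le hx he)

theorem abs_dotVec_le (hW : HtLe W A) (hx : HtLe x B) (he : ErrLe ζ x E) :
    |(dotVec W x : ℝ)| ≤ B * |quadVal ζ W| + (2 + |ζ|) * (A * E) := by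
  have : (dotVec W x : ℝ) = x 0 * quadVal ζ W
      - ((W 1 + W 2 * ζ) * (ζ * x 0 - x 1) + W 2 * (ζ * x 1 - x 2)) := by
    simp only [dotVec, quadVal]; push_cast; ring
  rw [this]
  refine (abs_sub _ _).trans ?_
  have hA := hW.nonneg
  have hE := he.nonneg
  have h1 : |(W 1 : ℝ) + W 2 * ζ| ≤ A + A * |ζ| := by
    refine (abs_add_le _ _).trans ?_
    rw [abs_mul]
    gcongr
    · exact hW 1
    · exact hW 2
  have h2 : |((W 1 : ℝ) + W 2 * ζ) * (ζ * x 0 - x 1)| ≤ (A + A * |ζ|) * E := by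
    rw [abs_mul]; gcongr; exact he.1
  have h3 : |(W 2 : ℝ) * (ζ * x 1 - x 2)| ≤ A * E := by
    rw [abs_mul]; gcongr; exacts [hW 2, he.2]
  have h4 : |(x 0 : ℝ) * quadVal ζ W| ≤ B * |quadVal ζ W| := by
    rw [abs_mul]; gcongr; exact hx 0
  have := abs_add_le (((W 1 : ℝ) + W 2 * ζ) * (ζ * x 0 - x 1)) ((W 2 : ℝ) * (ζ * x 1 - x 2))
  linarith

/-- An integer vector on the conic `x 0 * x 2 = x 1 ^ 2` is a multiple of a primitive point. -/
theorem exists_sq_param (hdet : symDet x = 0) (hx : x ≠ 0) : ∃ d q p : ℤ, d ≠ 0 ∧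
    IsCoprime q p ∧ x 0 = d * q ^ 2 ∧ x 1 = d * (q * p) ∧ x 2 = d * p ^ 2 := by
  simp only [symDet] at hdet
  by_cases h0 : x 0 = 0
  · have h1 : x 1 = 0 := by
      rw [h0] at hdet; simpa using hdet
    refine ⟨x 2, 0, 1, ?_, isCoprime_zero_left.mpr isUnit_one, by simp [h0], by simp [h1], by simp⟩
    intro h2
    apply hx
    ext i
    fin_cases i <;> simp [h0, h1, h2]
  · have hg : 0 < Int.gcd (x 0) (x 1) := Int.gcd_pos_of_ne_zero_left _ h0
    obtain ⟨q, p, hqp, hq, hp⟩ := Int.exists_gcd_one hg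
    set g : ℤ := (Int.gcd (x 0) (x 1) : ℤ) with hgdef
    have hg0 : g ≠ 0 := by positivity
    have hcop : IsCoprime q p := Int.isCoprime_iff_gcd_eq_one.mpr hqp
    have hq0 : q ≠ 0 := by rintro rfl; simp at hq; exact h0 hq
    have e : q * x 2 = g * p ^ 2 := by
      apply mul_left_cancel₀ hg0
      have := hdet
      rw [hq, hp] at this
      linear_combination this
    have hdvd : q ∣ g := (hcop.pow_right (n := 2)).dvd_of_dvd_mul_right ⟨x 2, e.symm⟩
    obtain ⟨d, hd⟩ := hdvd
    refine ⟨d, q, p, ?_, hcop, ?_, ?_, ?_⟩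
    · rintro rfl; simp at hd; exact hg0 hd
    · rw [hq, hd]; ring
    · rw [hp, hd]; ring
    · apply mul_left_cancel₀ hq0
      rw [e, hd]; ring

end Vectors

/-- `ζ` is approximated by rationals with exponent at most `1 + θ`. -/
def LinGood (ζ θ : ℝ) : Prop := ∃ C : ℝ, ∀ q p : ℤ, ¬(q = 0 ∧ p = 0) → ∀ s : ℝ,
  |(q : ℝ)| ≤ Real.exp s → |(p : ℝ)| ≤ Real.exp s →
  Real.exp (-((1 + θ) * s) - C) ≤ |ζ * q - p|

/-- Every nonzero integer polynomial of degree at most two has a nonzero value at `ζ`. -/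
def QuadIndep (ζ : ℝ) : Prop := ∀ P : Fin 3 → ℤ, P ≠ 0 → quadVal ζ P ≠ 0

/-- Uniform smallness of values at `ζ` with exponent `η`. -/
def UnifExp (ζ η : ℝ) : Prop := ∃ s₀ : ℝ, ∀ s : ℝ, s₀ ≤ s → ∃ P : Fin 3 → ℤ, P ≠ 0 ∧
  HtLe P (Real.exp s) ∧ |quadVal ζ P| ≤ Real.exp (-(η * s))

section Rational

variable {ζ θ : ℝ}

theorem QuadIndep.lin_ne_zero (hT : QuadIndep ζ) {q p : ℤ} (h : ¬(q = 0 ∧ p = 0)) :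
    ζ * q - p ≠ 0 := by
  intro h0
  refine hT ![-p, q, 0] ?_ ?_
  · intro h1
    have e0 := congrFun h1 0
    have e1 := congrFun h1 1
    simp at e0 e1
    exact h ⟨e1, e0⟩
  · simp [quadVal]; linarith

theorem nonneg_of_pair {q p : ℤ} (h : ¬(q = 0 ∧ p = 0)) {s : ℝ}
    (hq : |(q : ℝ)| ≤ Real.exp s) (hp : |(p : ℝ)| ≤ Real.exp s) : 0 ≤ s := by
  rw [← Real.one_le_exp_iff]
  by_cases h0 : q = 0
  · exact (one_le_abs_intCast (fun h1 => h ⟨h0, h1⟩)).trans hp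
  · exact (one_le_abs_intCast h0).trans hq

theorem linGood_of_eventually (s₀ : ℝ)
    (h : ∀ q p : ℤ, ¬(q = 0 ∧ p = 0) → ∀ s : ℝ, s₀ ≤ s → |(q : ℝ)| ≤ Real.exp s →
      |(p : ℝ)| ≤ Real.exp s → Real.exp (-((1 + θ) * s)) ≤ |ζ * q - p|) : LinGood ζ θ := by
  refine ⟨(1 + θ) * |s₀|, fun q p hqp s hq hp => ?_⟩
  have hs := nonneg_of_pair hqp hq hp
  have hle : s ≤ s + |s₀| := by linarith [abs_nonneg s₀]
  refine le_trans ?_ (h q p hqp (s + |s₀|) (by linarith [le_abs_self s₀])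
    (hq.trans (Real.exp_le_exp.mpr hle)) (hp.trans (Real.exp_le_exp.mpr hle)))
  apply Real.exp_le_exp.mpr
  linarith

theorem LinGood.mono {θ' : ℝ} (h : LinGood ζ θ) (hle : θ ≤ θ') : LinGood ζ θ' := by
  obtain ⟨C, hC⟩ := h
  refine ⟨C, fun q p hqp s hq hp => le_trans ?_ (hC q p hqp s hq hp)⟩
  have hs := nonneg_of_pair hqp hq hp
  apply Real.exp_le_exp.mpr
  nlinarith

theorem exists_pos_le_lin (hT : QuadIndep ζ) (M : ℝ) : ∃ e₀ : ℝ, 0 < e₀ ∧ ∀ q p : ℤ,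
    ¬(q = 0 ∧ p = 0) → |(q : ℝ)| ≤ M → |(p : ℝ)| ≤ M → e₀ ≤ |ζ * q - p| := by
  classical
  set N : ℤ := ⌈M⌉
  set S : Finset (ℤ × ℤ) := (Finset.Icc (-N) N ×ˢ Finset.Icc (-N) N).filter
    fun a => ¬(a.1 = 0 ∧ a.2 = 0)
  have hmem : ∀ q p : ℤ, ¬(q = 0 ∧ p = 0) → |(q : ℝ)| ≤ M → |(p : ℝ)| ≤ M → (q, p) ∈ S := by
    have hb : ∀ n : ℤ, |(n : ℝ)| ≤ M → n ∈ Finset.Icc (-N) N := by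
      intro n hn
      have : |n| ≤ N := by exact_mod_cast hn.trans (Int.le_ceil M)
      rw [Finset.mem_Icc]
      exact abs_le.mp this
    intro q p h hq hp
    simp only [S, Finset.mem_filter, Finset.mem_product]
    exact ⟨⟨hb q hq, hb p hp⟩, h⟩
  rcases S.eq_empty_or_nonempty with hS | hS
  · refine ⟨1, one_pos, fun q p h hq hp => ?_⟩
    have := hmem q p h hq hp
    simp [hS] at this
  · obtain ⟨a, ha, hmin⟩ := S.exists_min_image (fun a => |ζ * a.1 - a.2|) hS
    refine ⟨|ζ * a.1 - a.2|, abs_pos.mpr (hT.lin_ne_zero (Finset.mem_filter.mp ha).2),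
      fun q p h hq hp => hmin (q, p) (hmem q p h hq hp)⟩

theorem dvd_and_dvd_of_quad {P : Fin 3 → ℤ} {q p : ℤ} (hcop : IsCoprime q p)
    (h : P 0 * q ^ 2 + P 1 * (q * p) + P 2 * p ^ 2 = 0) : q ∣ P 2 ∧ p ∣ P 0 := by
  constructor
  · refine (hcop.pow_right (n := 2)).dvd_of_dvd_mul_right ⟨-(P 0 * q + P 1 * p), ?_⟩
    linear_combination h
  · refine (hcop.symm.pow_right (n := 2)).dvd_of_dvd_mul_right ⟨-(P 1 * q + P 2 * p), ?_⟩
    linear_combination h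

theorem eq_zero_of_dvd_of_abs_lt {a b : ℤ} (h : a ∣ b) (hlt : |b| < |a|) : b = 0 :=
  Int.eq_zero_of_abs_lt_dvd ((abs_dvd a b).mpr h) hlt

/-- A form of height smaller than the point at which it vanishes is zero. -/
theorem eq_zero_of_quad_eq_zero {P : Fin 3 → ℤ} {q p : ℤ} (hcop : IsCoprime q p)
    (h : P 0 * q ^ 2 + P 1 * (q * p) + P 2 * p ^ 2 = 0)
    (hlt : ∀ i, |P i| < max |q| |p|) : P = 0 := by
  obtain ⟨h2, h0⟩ := dvd_and_dvd_of_quad hcop h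
  rcases max_choice |q| |p| with hm | hm <;> rw [hm] at hlt
  · have e2 := eq_zero_of_dvd_of_abs_lt h2 (hlt 2)
    have hq : q ≠ 0 := by rintro rfl; have := hlt 0; simp at this; linarith [abs_nonneg (P 0)]
    have h' : P 0 * q + P 1 * p = 0 := by
      apply mul_left_cancel₀ hq; rw [e2] at h; linear_combination h
    have e1 : P 1 = 0 := by
      refine eq_zero_of_dvd_of_abs_lt (hcop.dvd_of_dvd_mul_right ⟨-P 0, ?_⟩) (hlt 1)
      linear_combination h'
    have e0 : P 0 = 0 := by
      rw [e1] at h'; simpa [hq] using h'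
    ext i; fin_cases i <;> simp [e0, e1, e2]
  · have e0 := eq_zero_of_dvd_of_abs_lt h0 (hlt 0)
    have hp : p ≠ 0 := by rintro rfl; have := hlt 0; simp at this; linarith [abs_nonneg (P 0)]
    have h' : P 1 * q + P 2 * p = 0 := by
      apply mul_left_cancel₀ hp; rw [e0] at h; linear_combination h
    have e1 : P 1 = 0 := by
      refine eq_zero_of_dvd_of_abs_lt (hcop.symm.dvd_of_dvd_mul_right ⟨-P 2, ?_⟩) (hlt 1)
      linear_combination h'
    have e2 : P 2 = 0 := by
      rw [e1] at h'; simpa [hp] using h'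
    ext i; fin_cases i <;> simp [e0, e1, e2]

theorem abs_quad_le {P : Fin 3 → ℤ} {q p : ℤ} {X m : ℝ} (hP : HtLe P X)
    (hq : |(q : ℝ)| ≤ m) (hp : |(p : ℝ)| ≤ m) :
    |((P 0 * q ^ 2 + P 1 * (q * p) + P 2 * p ^ 2 : ℤ) : ℝ)|
      ≤ m ^ 2 * |quadVal ζ P| + (2 + |ζ|) * (X * m * |ζ * q - p|) := by
  have e : ((P 0 * q ^ 2 + P 1 * (q * p) + P 2 * p ^ 2 : ℤ) : ℝ)
      = q ^ 2 * quadVal ζ P - (ζ * q - p) * (P 1 * q + P 2 * (ζ * q + p)) := by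
    simp only [quadVal]; push_cast; ring
  rw [e]
  refine (abs_sub _ _).trans ?_
  have hX := hP.nonneg
  have hm := (abs_nonneg _).trans hq
  have h1 : |(q : ℝ) ^ 2 * quadVal ζ P| ≤ m ^ 2 * |quadVal ζ P| := by
    rw [abs_mul, abs_pow]; gcongr
  have h2 : |(P 1 : ℝ) * q + P 2 * (ζ * q + p)| ≤ X * m + X * (|ζ| * m + m) := by
    refine (abs_add_le _ _).trans ?_
    have h3 : |ζ * q + p| ≤ |ζ| * m + m := by
      refine (abs_add_le _ _).trans ?_
      rw [abs_mul]; gcongr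
    rw [abs_mul, abs_mul]
    gcongr
    exacts [hP 1, hP 2]
  have h4 : |(ζ * q - p) * (P 1 * q + P 2 * (ζ * q + p))|
      ≤ |ζ * q - p| * (X * m + X * (|ζ| * m + m)) := by
    rw [abs_mul]; gcongr
  linarith

theorem exists_coprime_lower (hT : QuadIndep ζ) (hU : UnifExp ζ (13 / 5)) :
    ∃ C : ℝ, ∀ q p : ℤ, IsCoprime q p → ∀ s : ℝ, |(q : ℝ)| ≤ Real.exp s →
      |(p : ℝ)| ≤ Real.exp s → Real.exp (-((1 + 9 / 10) * s) - C) ≤ |ζ * q - p| := by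
  obtain ⟨t₀, hU⟩ := hU
  obtain ⟨s₁, hs₁, hs₁'⟩ : ∃ s₁ : ℝ, 0 < s₁ ∧ ∀ s, s₁ ≤ s →
      Real.exp (-(2 / 25 * s)) + (2 + |ζ|) * Real.exp (-(1 / 10 * s)) < 1 := by
    have h1 : Filter.Tendsto (fun s : ℝ => Real.exp (-(2 / 25 * s))
        + (2 + |ζ|) * Real.exp (-(1 / 10 * s))) Filter.atTop (nhds (0 + (2 + |ζ|) * 0)) := by
      refine Filter.Tendsto.add ?_ (Filter.Tendsto.const_mul _ ?_)
      · exact Real.tendsto_exp_neg_atTop_nhds_zero.comp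
          (Filter.tendsto_id.const_mul_atTop (by norm_num))
      · exact Real.tendsto_exp_neg_atTop_nhds_zero.comp
          (Filter.tendsto_id.const_mul_atTop (by norm_num))
    have h2 := (h1.eventually (gt_mem_nhds (by simp : (0 + (2 + |ζ|) * 0 : ℝ) < 1)))
    obtain ⟨a, ha⟩ := Filter.eventually_atTop.mp h2
    exact ⟨max a 1, by positivity, fun s hs => ha s ((le_max_left _ _).trans hs)⟩
  set s₀ := max s₁ (5 / 4 * t₀) with hs₀
  obtain ⟨e₀, he₀, hmin⟩ := exists_pos_le_lin hT (Real.exp s₀)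
  refine ⟨|Real.log e₀|, fun q p hcop s hq hp => ?_⟩
  have hne : ¬(q = 0 ∧ p = 0) := by
    rintro ⟨rfl, rfl⟩
    exact not_isCoprime_zero_zero hcop
  have hs := nonneg_of_pair hne hq hp
  have hlog : Real.exp (-((1 + 9 / 10) * s) - |Real.log e₀|) ≤ e₀ := by
    rw [← Real.le_log_iff_exp_le he₀]
    linarith [neg_abs_le (Real.log e₀)]
  set m : ℤ := max |q| |p| with hm
  have hmR : (m : ℝ) = max |(q : ℝ)| |(p : ℝ)| := by rw [hm]; push_cast; rfl
  have hm1 : (1 : ℝ) ≤ m := by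
    rw [hmR]
    by_cases h0 : q = 0
    · exact (one_le_abs_intCast (fun h1 => hne ⟨h0, h1⟩)).trans (le_max_right _ _)
    · exact (one_le_abs_intCast h0).trans (le_max_left _ _)
  obtain ⟨σ, hσ⟩ : ∃ σ, Real.exp σ = m := ⟨Real.log m, Real.exp_log (by linarith)⟩
  have hσs : σ ≤ s := by
    rw [← Real.exp_le_exp, hσ, hmR]; exact max_le hq hp
  have hqm : |(q : ℝ)| ≤ Real.exp σ := by rw [hσ, hmR]; exact le_max_left _ _
  have hpm : |(p : ℝ)| ≤ Real.exp σ := by rw [hσ, hmR]; exact le_max_right _ _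
  rcases lt_or_ge σ s₀ with hlt | hge
  · refine hlog.trans (hmin q p hne (hqm.trans ?_) (hpm.trans ?_)) <;>
      exact Real.exp_le_exp.mpr hlt.le
  · by_contra! hcon
    have he : |ζ * q - p| ≤ Real.exp (-((1 + 9 / 10) * σ)) := by
      refine hcon.le.trans (Real.exp_le_exp.mpr ?_)
      linarith [abs_nonneg (Real.log e₀)]
    have hσ1 : s₁ ≤ σ := (le_max_left _ _).trans hge
    have hσ2 : t₀ ≤ 4 / 5 * σ := by
      have := (le_max_right s₁ (5 / 4 * t₀)).trans hge
      linarith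
    obtain ⟨P, hP0, hPh, hPv⟩ := hU _ hσ2
    apply hP0
    refine eq_zero_of_quad_eq_zero hcop ?_ fun i => ?_
    · by_contra hN
      have h1 := (one_le_abs_intCast hN).trans (abs_quad_le (ζ := ζ) hPh hqm hpm)
      have h2 : Real.exp σ ^ 2 * |quadVal ζ P| ≤ Real.exp (-(2 / 25 * σ)) := by
        calc Real.exp σ ^ 2 * |quadVal ζ P|
            ≤ Real.exp σ ^ 2 * Real.exp (-(13 / 5 * (4 / 5 * σ))) := by gcongr
          _ = Real.exp (-(2 / 25 * σ)) := by
            rw [← Real.exp_nat_mul, ← Real.exp_add]; congr 1; push_cast; ring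
      have h3 : Real.exp (4 / 5 * σ) * Real.exp σ * |ζ * q - p| ≤ Real.exp (-(1 / 10 * σ)) := by
        calc Real.exp (4 / 5 * σ) * Real.exp σ * |ζ * q - p|
            ≤ Real.exp (4 / 5 * σ) * Real.exp σ * Real.exp (-((1 + 9 / 10) * σ)) := by gcongr
          _ = Real.exp (-(1 / 10 * σ)) := by
            rw [← Real.exp_add, ← Real.exp_add]; congr 1; ring
      have h4 := mul_le_mul_of_nonneg_left h3 (by positivity : (0 : ℝ) ≤ 2 + |ζ|)
      linarith [hs₁' σ hσ1]
    · have : (|P i| : ℝ) < m := by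
        rw [← hσ]
        refine (hPh i).trans_lt (Real.exp_lt_exp.mpr ?_)
        linarith
      exact_mod_cast this

theorem linGood_nine_tenths (hT : QuadIndep ζ) (hU : UnifExp ζ (13 / 5)) :
    LinGood ζ (9 / 10) := by
  obtain ⟨C, hC⟩ := exists_coprime_lower hT hU
  refine ⟨C, fun q p hqp s hq hp => ?_⟩
  have hg : 0 < Int.gcd q p := by
    rw [Nat.pos_iff_ne_zero]; intro h; exact hqp (Int.gcd_eq_zero_iff.mp h)
  obtain ⟨q', p', hcop, hq', hp'⟩ := Int.exists_gcd_one hg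
  have hg1 : (1 : ℝ) ≤ (Int.gcd q p : ℝ) := by exact_mod_cast hg
  have hqR : (q : ℝ) = q' * (Int.gcd q p : ℝ) := by exact_mod_cast hq'
  have hpR : (p : ℝ) = p' * (Int.gcd q p : ℝ) := by exact_mod_cast hp'
  have hmono : ∀ a : ℝ, |a| ≤ |a * (Int.gcd q p : ℝ)| := by
    intro a
    rw [abs_mul, abs_of_nonneg (by linarith : (0 : ℝ) ≤ (Int.gcd q p : ℝ))]
    nlinarith [abs_nonneg a]
  refine (hC q' p' (Int.isCoprime_iff_gcd_eq_one.mpr hcop) s ?_ ?_).trans ?_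
  · exact (hmono _).trans (hqR ▸ hq)
  · exact (hmono _).trans (hpR ▸ hp)
  · refine (hmono _).trans (le_of_eq ?_)
    congr 1
    rw [hqR, hpR]; ring

end Rational

/-- A logarithmic constant absorbing the dependence of the estimates on `ζ`. -/
noncomputable def logC (ζ : ℝ) : ℝ := Real.log (2 + |ζ|)

section ExpBounds

open Real

variable {ζ : ℝ} {P Q W x y : Fin 3 → ℤ} {a b e l m u : ℝ}

theorem exp_logC (ζ : ℝ) : exp (logC ζ) = 2 + |ζ| := Real.exp_log (by positivity)

theorem logC_nonneg (ζ : ℝ) : 0 ≤ logC ζ := Real.log_nonneg (by linarith [abs_nonneg ζ])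

theorem two_le_exp_one : (2 : ℝ) ≤ exp 1 := by
  have := Real.add_one_le_exp (1 : ℝ); linarith

theorem htLe_crossVec_exp (hP : HtLe P (exp a)) (hQ : HtLe Q (exp b)) :
    HtLe (crossVec P Q) (exp (a + b + 1)) := by
  refine (htLe_crossVec hP hQ).mono ?_
  rw [exp_add, exp_add, mul_comm]
  gcongr
  exact two_le_exp_one

theorem errLe_crossVec_exp (hP : HtLe P (exp a)) (hQ : HtLe Q (exp b))
    (hl : |quadVal ζ P| ≤ exp l) (hm : |quadVal ζ Q| ≤ exp m) (h1 : b + l ≤ e) (h2 : a + m ≤ e) :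
    ErrLe ζ (crossVec P Q) (exp (e + 1 + logC ζ)) := by
  refine (errLe_crossVec hP hQ hl hm).mono ?_
  rw [exp_add, exp_add, exp_logC, ← exp_add, ← exp_add]
  have e1 := exp_le_exp.mpr h1
  have e2 := exp_le_exp.mpr h2
  calc (1 + |ζ|) * (exp (b + l) + exp (a + m)) ≤ (2 + |ζ|) * (exp e + exp e) := by
        gcongr; norm_num
    _ = exp e * 2 * (2 + |ζ|) := by ring
    _ ≤ _ := by gcongr; exact two_le_exp_one

theorem nonneg_of_one_le_two_mul (h : 1 ≤ 2 * (exp b * exp e)) : 0 ≤ b + e + 1 := by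
  rw [← one_le_exp_iff, exp_add, exp_add]
  nlinarith [two_le_exp_one, exp_pos b, exp_pos e, mul_pos (exp_pos b) (exp_pos e)]

theorem nonneg_of_parallel (hx : HtLe x (exp b)) (he : ErrLe ζ y (exp e))
    (hpar : crossVec x y = 0) (hdet : symDet x ≠ 0) (hy : y ≠ 0) : 0 ≤ b + e + 1 :=
  nonneg_of_one_le_two_mul (one_le_of_parallel hx he hpar hdet hy)

theorem abs_symDet_le_exp (hx : HtLe x (exp b)) (he : ErrLe ζ x (exp e)) :
    |(symDet x : ℝ)| ≤ exp (b + e + 1) := by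
  refine (symDet_le hx he).trans ?_
  rw [exp_add, exp_add, mul_comm]
  gcongr
  exact two_le_exp_one

theorem abs_dotVec_le_exp (hW : HtLe W (exp a)) (hx : HtLe x (exp b)) (he : ErrLe ζ x (exp e))
    (hl : |quadVal ζ W| ≤ exp l) (h1 : b + l ≤ u) (h2 : a + e ≤ u) :
    |(dotVec W x : ℝ)| ≤ exp (u + 1 + logC ζ) := by
  refine (abs_dotVec_le hW hx he).trans ?_
  rw [exp_add, exp_add, exp_logC, ← exp_add]
  have e1 := exp_le_exp.mpr h1
  have e2 := exp_le_exp.mpr h2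
  have e3 : exp b * |quadVal ζ W| ≤ exp u := by
    refine le_trans ?_ e1
    rw [exp_add]; gcongr
  calc exp b * |quadVal ζ W| + (2 + |ζ|) * exp (a + e) ≤ exp u + (2 + |ζ|) * exp u := by gcongr
    _ ≤ exp u * 2 * (2 + |ζ|) := by nlinarith [exp_pos u, abs_nonneg ζ]
    _ ≤ _ := by gcongr; exact two_le_exp_one

theorem nonneg_of_dotVec_ne_zero (hW : HtLe W (exp a)) (hx : HtLe x (exp b))
    (he : ErrLe ζ x (exp e)) (hl : |quadVal ζ W| ≤ exp l) (h1 : b + l ≤ u) (h2 : a + e ≤ u)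
    (hne : dotVec W x ≠ 0) : 0 ≤ u + 1 + logC ζ := by
  rw [← one_le_exp_iff]
  exact (one_le_abs_intCast hne).trans (abs_dotVec_le_exp hW hx he hl h1 h2)

end ExpBounds

/-- The maximum of the absolute values of the coefficients. -/
def hgt (P : Fin 3 → ℤ) : ℕ := Finset.univ.sup fun i => (P i).natAbs

/-- `P` minimizes `|quadVal ζ P|` among nonzero vectors of height at most `n`. -/
def IsMinPt (ζ : ℝ) (n : ℕ) (P : Fin 3 → ℤ) : Prop :=
  P ≠ 0 ∧ hgt P ≤ n ∧ ∀ Q : Fin 3 → ℤ, Q ≠ 0 → hgt Q ≤ n → |quadVal ζ P| ≤ |quadVal ζ Q|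

section Minimal

open Real

variable {ζ : ℝ} {P Q W : Fin 3 → ℤ} {n m : ℕ}

theorem natAbs_le_hgt (P : Fin 3 → ℤ) (i : Fin 3) : (P i).natAbs ≤ hgt P :=
  Finset.le_sup (f := fun i => (P i).natAbs) (Finset.mem_univ i)

theorem htLe_natCast_iff : HtLe P n ↔ hgt P ≤ n := by
  have key : ∀ i, |(P i : ℝ)| ≤ n ↔ (P i).natAbs ≤ n := by
    intro i
    rw [← Int.cast_abs, Int.abs_eq_natAbs]
    norm_cast
  simp only [HtLe, hgt, Finset.sup_le_iff, Finset.mem_univ, true_imp_iff, key]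

theorem exists_natAbs_eq_hgt (P : Fin 3 → ℤ) : ∃ i, (P i).natAbs = hgt P := by
  obtain ⟨i, -, hi⟩ := Finset.exists_mem_eq_sup Finset.univ Finset.univ_nonempty
    (fun i => (P i).natAbs)
  exact ⟨i, hi.symm⟩

theorem hgt_pos (hP : P ≠ 0) : 1 ≤ hgt P := by
  obtain ⟨i, hi⟩ := exists_ne_zero_of_ne_zero hP
  exact (Int.natAbs_pos.mpr hi).trans_le (natAbs_le_hgt P i)

theorem htLe_exp_log (hn : 1 ≤ n) (h : hgt P ≤ n) : HtLe P (exp (log n)) := by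
  rw [exp_log (by exact_mod_cast hn)]
  exact htLe_natCast_iff.mpr h

theorem exists_isMinPt (ζ : ℝ) (hn : 1 ≤ n) : ∃ P, IsMinPt ζ n P := by
  classical
  set S : Finset (Fin 3 → ℤ) :=
    (Fintype.piFinset fun _ => Finset.Icc (-(n : ℤ)) n).filter (· ≠ 0) with hS
  have hmem : ∀ P, P ∈ S ↔ P ≠ 0 ∧ hgt P ≤ n := by
    intro P
    have key : ∀ i, (-(n : ℤ) ≤ P i ∧ P i ≤ n) ↔ (P i).natAbs ≤ n := by intro i; omega
    simp only [hS, Finset.mem_filter, Fintype.mem_piFinset, Finset.mem_Icc, key, hgt,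
      Finset.sup_le_iff, Finset.mem_univ, true_imp_iff]
    tauto
  have hne : S.Nonempty := by
    refine ⟨fun _ => 1, (hmem _).mpr ⟨fun h => by simpa using congrFun h 0, ?_⟩⟩
    simpa [hgt] using hn
  obtain ⟨P, hP, hmin⟩ := S.exists_min_image (fun P => |quadVal ζ P|) hne
  exact ⟨P, ((hmem P).mp hP).1, ((hmem P).mp hP).2, fun Q h0 hQ => hmin Q ((hmem Q).mpr ⟨h0, hQ⟩)⟩

theorem crossVec_ne_zero_of_hgt_lt (hT : QuadIndep ζ) (hW : W ≠ 0) (hlt : hgt W < hgt P)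
    (hle : |quadVal ζ P| ≤ |quadVal ζ W|) : crossVec W P ≠ 0 := by
  intro h
  rw [crossVec_eq_zero_iff] at h
  obtain ⟨i, hi⟩ := exists_natAbs_eq_hgt P
  have h0 : 0 < |quadVal ζ W| := abs_pos.mpr (hT W hW)
  have e : (P i : ℝ) * quadVal ζ W = W i * quadVal ζ P := by
    have h' : ∀ j, (W i : ℝ) * P j = W j * P i := fun j => by exact_mod_cast h i j
    simp only [quadVal]
    linear_combination -(h' 0 + ζ * h' 1 + ζ ^ 2 * h' 2)
  have e1 : |(P i : ℝ)| * |quadVal ζ W| = |(W i : ℝ)| * |quadVal ζ P| := by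
    rw [← abs_mul, ← abs_mul, e]
  have e2 : |(W i : ℝ)| < |(P i : ℝ)| := by
    rw [← Int.cast_abs, ← Int.cast_abs, Int.abs_eq_natAbs, Int.abs_eq_natAbs]
    have := (natAbs_le_hgt W i).trans_lt (hi ▸ hlt)
    exact_mod_cast this
  have := mul_le_mul_of_nonneg_left hle (abs_nonneg (W i : ℝ))
  nlinarith

theorem crossVec_eq_zero_of_abs_quadVal_eq (hT : QuadIndep ζ)
    (h : |quadVal ζ P| = |quadVal ζ Q|) : crossVec P Q = 0 := by
  rw [crossVec_eq_zero_iff]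
  rcases abs_eq_abs.mp h with h | h
  · have : P - Q = 0 := by
      by_contra h0
      apply hT _ h0
      simp only [quadVal, Pi.sub_apply] at *
      push_cast
      linear_combination h
    rw [sub_eq_zero.mp this]
    intro i j; ring
  · have : P + Q = 0 := by
      by_contra h0
      apply hT _ h0
      simp only [quadVal, Pi.add_apply] at *
      push_cast
      linear_combination h
    rw [eq_neg_of_add_eq_zero_left this]
    intro i j; simp; ring

theorem dotVec_eq_zero_of_parallel_left (hP : P ≠ 0) (h : crossVec P Q = 0)
    (h0 : dotVec P W = 0) : dotVec Q W = 0 := by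
  rw [crossVec_eq_zero_iff] at h
  obtain ⟨k, hk⟩ := exists_ne_zero_of_ne_zero hP
  apply mul_left_cancel₀ hk
  simp only [dotVec] at *
  linear_combination W 0 * h k 0 + W 1 * h k 1 + W 2 * h k 2 + Q k * h0

theorem IsMinPt.antitone (hP : IsMinPt ζ n P) (hQ : IsMinPt ζ m Q) (h : n ≤ m) :
    |quadVal ζ Q| ≤ |quadVal ζ P| := hQ.2.2 P hP.1 (hP.2.1.trans h)

theorem UnifExp.isMinPt_le {η : ℝ} (hU : UnifExp ζ η) : ∃ n₀ : ℕ, 2 ≤ n₀ ∧ ∀ n P, n₀ ≤ n →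
    IsMinPt ζ n P → |quadVal ζ P| ≤ exp (-(η * log n)) := by
  obtain ⟨s₀, hU⟩ := hU
  refine ⟨max 2 ⌈exp s₀⌉₊, le_max_left _ _, fun n P hn hP => ?_⟩
  have hn2 : 2 ≤ n := (le_max_left _ _).trans hn
  have hn0 : (0 : ℝ) < n := by positivity
  have hs : s₀ ≤ log n := by
    rw [le_log_iff_exp_le hn0]
    exact (Nat.le_ceil _).trans (by exact_mod_cast (le_max_right _ _).trans hn)
  obtain ⟨Q, hQ0, hQh, hQv⟩ := hU _ hs
  rw [exp_log hn0] at hQh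
  exact (hP.2.2 Q hQ0 (htLe_natCast_iff.mp hQh)).trans hQv

end Minimal

/-- A sequence of minimal points for `ζ` whose values decay with exponent `η` from `n₀` on. -/
structure MinSeq (ζ η : ℝ) (n₀ : ℕ) (P : ℕ → Fin 3 → ℤ) : Prop where
  two_le : 2 ≤ n₀
  le_eta : 13 / 5 ≤ η
  eta_le : η ≤ 3
  isMinPt : ∀ n, 1 ≤ n → IsMinPt ζ n (P n)
  val_le : ∀ n, n₀ ≤ n → |quadVal ζ (P n)| ≤ Real.exp (-(η * Real.log n))

/-- The cross product of two successive minimal points. -/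
def jumpVec (P : ℕ → Fin 3 → ℤ) (n : ℕ) : Fin 3 → ℤ := crossVec (P n) (P (n + 1))

section Jumps

open Real

variable {ζ η : ℝ} {n₀ n m : ℕ} {P : ℕ → Fin 3 → ℤ}

theorem log_succ_le (hn : 1 ≤ n) : log ((n + 1 : ℕ) : ℝ) ≤ log n + 1 := by
  have h1 : (1 : ℝ) ≤ n := by exact_mod_cast hn
  rw [← log_exp 1, ← log_mul (by positivity) (exp_pos 1).ne']
  apply log_le_log (by positivity)
  push_cast
  nlinarith [two_le_exp_one]

theorem log_nat_mono (hn : 1 ≤ n) (h : n ≤ m) : log (n : ℝ) ≤ log m :=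
  log_le_log (by exact_mod_cast hn) (by exact_mod_cast h)

theorem MinSeq.val_le_succ (h : MinSeq ζ η n₀ P) (hn : n₀ ≤ n) :
    |quadVal ζ (P n)| ≤ exp (3 - η * log ((n + 1 : ℕ) : ℝ)) := by
  refine (h.val_le n hn).trans (exp_le_exp.mpr ?_)
  have := log_succ_le (show 1 ≤ n by linarith [h.two_le])
  nlinarith [h.le_eta, h.eta_le]

theorem MinSeq.ne_zero (h : MinSeq ζ η n₀ P) (hn : n₀ ≤ n) : P n ≠ 0 :=
  (h.isMinPt n (by linarith [h.two_le])).1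

theorem MinSeq.htLe (h : MinSeq ζ η n₀ P) (hn : n₀ ≤ n) : HtLe (P n) (exp (log (hgt (P n)))) :=
  htLe_exp_log (hgt_pos (h.ne_zero hn)) le_rfl

theorem MinSeq.hgt_le (h : MinSeq ζ η n₀ P) (hn : n₀ ≤ n) : hgt (P n) ≤ n :=
  (h.isMinPt n (by linarith [h.two_le])).2.1

theorem MinSeq.log_hgt_le (h : MinSeq ζ η n₀ P) (hn : n₀ ≤ n) :
    log (hgt (P n)) ≤ log ((n + 1 : ℕ) : ℝ) :=
  log_nat_mono (hgt_pos (h.ne_zero hn)) ((h.hgt_le hn).trans (Nat.le_succ n))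

theorem MinSeq.htLe_index (h : MinSeq ζ η n₀ P) (hn : n₀ ≤ n) : HtLe (P n) (exp (log n)) :=
  htLe_exp_log (by linarith [h.two_le]) (h.hgt_le hn)

theorem MinSeq.htLe_jumpVec (h : MinSeq ζ η n₀ P) (hn : n₀ ≤ n) :
    HtLe (jumpVec P n) (exp (log (hgt (P n)) + log ((n + 1 : ℕ) : ℝ) + 1)) :=
  htLe_crossVec_exp (h.htLe hn) (h.htLe_index (by omega))

theorem MinSeq.errLe_jumpVec (h : MinSeq ζ η n₀ P) (hn : n₀ ≤ n) :
    ErrLe ζ (jumpVec P n)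
      (exp (log ((n + 1 : ℕ) : ℝ) + (3 - η * log ((n + 1 : ℕ) : ℝ)) + 1 + logC ζ)) := by
  refine errLe_crossVec_exp (h.htLe hn) (h.htLe_index (by omega)) (h.val_le_succ hn)
    (h.val_le (n + 1) (by omega)) le_rfl ?_
  linarith [h.log_hgt_le hn]

theorem abs_le_exp_half {d q : ℤ} (hd : d ≠ 0) {B : ℝ} (h : |((d * q ^ 2 : ℤ) : ℝ)| ≤ exp B) :
    |(q : ℝ)| ≤ exp (B / 2) := by
  have h1 := one_le_abs_intCast hd
  push_cast at h
  rw [abs_mul, abs_pow] at h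
  have h2 : |(q : ℝ)| ^ 2 ≤ exp (B / 2) ^ 2 := by
    rw [← exp_nat_mul]
    push_cast
    rw [mul_div_cancel₀ _ (by norm_num : (2 : ℝ) ≠ 0)]
    nlinarith [sq_nonneg |(q : ℝ)|]
  exact le_of_sq_le_sq h2 (exp_pos _).le

theorem MinSeq.symDet_jumpVec_ne_zero (h : MinSeq ζ η n₀ P) (hG : LinGood ζ (9 / 10)) :
    ∃ N, n₀ ≤ N ∧ ∀ n, N ≤ n → jumpVec P n ≠ 0 →
      symDet (jumpVec P n) ≠ 0 := by
  obtain ⟨C, hC⟩ := hG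
  obtain ⟨N, hN⟩ := exists_nat_gt (exp (2 * (5 + C + logC ζ)))
  refine ⟨max n₀ N, le_max_left _ _, fun n hn hj hdet => ?_⟩
  have hn₀ : n₀ ≤ n := (le_max_left _ _).trans hn
  set β := log ((n + 1 : ℕ) : ℝ) with hβ
  have hβN : 2 * (5 + C + logC ζ) < β := by
    rw [hβ, lt_log_iff_exp_lt (by positivity)]
    refine hN.trans_le ?_
    exact_mod_cast ((le_max_right _ _).trans hn).trans (Nat.le_succ n)
  obtain ⟨d, q, p, hd, hcop, e0, e1, e2⟩ := exists_sq_param hdet hj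
  have hne : ¬(q = 0 ∧ p = 0) := by
    rintro ⟨rfl, rfl⟩
    exact not_isCoprime_zero_zero hcop
  have hα := h.log_hgt_le hn₀
  have hx := h.htLe_jumpVec hn₀
  have herr := h.errLe_jumpVec hn₀
  rw [← hβ] at hx herr hα
  have hβ0 : 0 ≤ β := log_natCast_nonneg _
  have hb : ∀ r : ℤ, (∃ i, jumpVec P n i = d * r ^ 2) → |(r : ℝ)| ≤ exp (β + 1 / 2) := by
    rintro r ⟨i, hi⟩
    refine (abs_le_exp_half hd (hi ▸ hx i)).trans (exp_le_exp.mpr ?_)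
    linarith
  have hq := hb q ⟨0, e0⟩
  have hp := hb p ⟨2, e2⟩
  have hd1 := one_le_abs_intCast hd
  have main : ∀ r : ℤ, |(q : ℝ)| ≤ |(r : ℝ)| → |(p : ℝ)| ≤ |(r : ℝ)| →
      |(r : ℝ)| ≤ exp (β + 1 / 2) → |(d : ℝ) * r * (ζ * q - p)| ≤
        exp (β + (3 - η * β) + 1 + logC ζ) → False := by
    intro r hqr hpr hr herr
    have hr0 : r ≠ 0 := by
      rintro rfl
      apply hne
      simpa using And.intro hqr hpr
    have hr1 := one_le_abs_intCast hr0
    have hs : exp (log |(r : ℝ)|) = |(r : ℝ)| := exp_log (by linarith)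
    have hG := hC q p hne (log |(r : ℝ)|) (by rwa [hs]) (by rwa [hs])
    have hlog : log |(r : ℝ)| ≤ β + 1 / 2 := by
      rw [log_le_iff_le_exp (by linarith)]; exact hr
    have h1 : |(r : ℝ)| * |ζ * q - p| ≤ exp (β + (3 - η * β) + 1 + logC ζ) := by
      refine le_trans ?_ herr
      rw [abs_mul, abs_mul, mul_assoc]
      exact le_mul_of_one_le_left (by positivity) hd1
    have h2 : exp (log |(r : ℝ)| + (-((1 + 9 / 10) * log |(r : ℝ)|) - C))
        ≤ exp (β + (3 - η * β) + 1 + logC ζ) := by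
      refine le_trans ?_ h1
      rw [exp_add, hs]
      gcongr
    have h3 := exp_le_exp.mp h2
    nlinarith [h.le_eta]
  rcases le_total |(q : ℝ)| |(p : ℝ)| with hqp | hqp
  · refine main p hqp le_rfl hp ?_
    have := herr.2
    rw [e1, e2] at this
    push_cast at this
    convert this using 2
    ring
  · refine main q le_rfl hqp hq ?_
    have := herr.1
    rw [e0, e1] at this
    push_cast at this
    convert this using 2
    ring

theorem exists_log_gt (B : ℝ) : ∃ N : ℕ, ∀ n, N ≤ n → B < log (n : ℝ) := by
  obtain ⟨N, hN⟩ := exists_nat_gt (exp B)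
  refine ⟨N, fun n hn => ?_⟩
  have : exp B < n := hN.trans_le (by exact_mod_cast hn)
  rwa [lt_log_iff_exp_lt ((exp_pos B).trans this)]

theorem MinSeq.exists_jump (h : MinSeq ζ η n₀ P) (hT : QuadIndep ζ) (N : ℕ) :
    ∃ n, N ≤ n ∧ jumpVec P n ≠ 0 := by
  by_contra! hcon
  set M := max N n₀ with hM
  have hpar : ∀ k, crossVec (P M) (P (M + k)) = 0 := by
    intro k
    induction k with
    | zero => rw [crossVec_eq_zero_iff]; intro i j; simp only [add_zero]; ring
    | succ k ih =>
      refine crossVec_parallel_trans (h.ne_zero (by omega)) ih ?_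
      exact hcon (M + k) (by omega)
  have hMne := h.ne_zero (show n₀ ≤ M from le_max_right _ _)
  obtain ⟨i, hi⟩ := exists_ne_zero_of_ne_zero hMne
  set v := |quadVal ζ (P M)| with hv
  have hv0 : 0 < v := abs_pos.mpr (hT _ hMne)
  have hi1 := one_le_abs_intCast hi
  obtain ⟨N', hN'⟩ := exists_log_gt (log (|(P M i : ℝ)| / v))
  have hkey := hpar N'
  set k := M + N' with hk
  have hkn : n₀ ≤ k := by omega
  rw [crossVec_eq_zero_iff] at hkey
  have hki : P k i ≠ 0 := by
    intro h0
    obtain ⟨j, hj⟩ := exists_ne_zero_of_ne_zero (h.ne_zero hkn)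
    have := hkey i j
    rw [h0, mul_zero] at this
    exact mul_ne_zero hi hj this
  have hki1 := one_le_abs_intCast hki
  have e : (P k i : ℝ) * quadVal ζ (P M) = P M i * quadVal ζ (P k) := by
    have h' : ∀ j, (P M i : ℝ) * P k j = P M j * P k i := fun j => by exact_mod_cast hkey i j
    simp only [quadVal]
    linear_combination -(h' 0 + ζ * h' 1 + ζ ^ 2 * h' 2)
  have e1 : |(P k i : ℝ)| * v = |(P M i : ℝ)| * |quadVal ζ (P k)| := by
    rw [hv, ← abs_mul, ← abs_mul, e]
  have h1 := h.val_le k hkn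
  have h2 := hN' k (by omega)
  have hlk : 0 ≤ log (k : ℝ) := log_natCast_nonneg _
  have h3 : |quadVal ζ (P k)| < v / |(P M i : ℝ)| := by
    refine h1.trans_lt ?_
    rw [← lt_log_iff_exp_lt (by positivity)]
    have : log (v / |(P M i : ℝ)|) = -log (|(P M i : ℝ)| / v) := by
      rw [← log_inv, inv_div]
    rw [this]
    nlinarith [h.le_eta]
  rw [lt_div_iff₀ (by positivity)] at h3
  nlinarith

end Jumps

section Chain

open Real

variable {ζ η : ℝ} {n₀ n m N : ℕ} {P : ℕ → Fin 3 → ℤ}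

/-- The relations between two consecutive turning points `n` and `m`. -/
structure TurnRel (ζ η : ℝ) (P : ℕ → Fin 3 → ℤ) (n m : ℕ) : Prop where
  lt : n < m
  jump : jumpVec P m ≠ 0
  succ_le_hgt : n + 1 ≤ hgt (P m)
  det : symDet (crossVec (P n) (P m)) ≠ 0
  le_left : (η - 1) * log (hgt (P m)) ≤
    log (hgt (P n)) + log ((n + 1 : ℕ) : ℝ) + (6 + 2 * logC ζ)
  le_right : (η - 1) * log (hgt (P m)) ≤ log ((m + 1 : ℕ) : ℝ) + (6 + 2 * logC ζ)

theorem MinSeq.exists_dotVec_ne_zero (h : MinSeq ζ η n₀ P) (hT : QuadIndep ζ) (hn : n₀ ≤ n)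
    (hdet : symDet (jumpVec P n) ≠ 0) : ∃ k, n < k ∧ dotVec (P k) (jumpVec P n) ≠ 0 := by
  by_contra! hcon
  set B := log (hgt (P n)) + log ((n + 1 : ℕ) : ℝ) + 1 with hB
  obtain ⟨N, hN⟩ := exists_log_gt (B + 6 + logC ζ)
  obtain ⟨k, hk, hj⟩ := h.exists_jump hT (max N (n + 1))
  have hkn : n < k := by omega
  have hpar := crossVec_crossVec_of_dotVec (hcon k hkn) (hcon (k + 1) (by omega))
  have h1 := nonneg_of_parallel (h.htLe_jumpVec hn) (h.errLe_jumpVec (show n₀ ≤ k by omega))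
    (crossVec_parallel_symm hpar) hdet hj
  have h2 := hN (k + 1) (by omega)
  have h3 : 0 ≤ log ((k + 1 : ℕ) : ℝ) := log_natCast_nonneg _
  nlinarith [h.le_eta]

theorem MinSeq.exists_next (h : MinSeq ζ η n₀ P) (hT : QuadIndep ζ) (hn : n₀ ≤ n)
    (hjump : jumpVec P n ≠ 0) (hdet : symDet (jumpVec P n) ≠ 0) : ∃ m, TurnRel ζ η P n m := by
  classical
  have hex := h.exists_dotVec_ne_zero hT hn hdet
  obtain ⟨hlt, hne⟩ := Nat.find_spec hex
  have hmin : ∀ k, n < k → k < Nat.find hex → dotVec (P k) (jumpVec P n) = 0 := by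
    intro k h1 h2
    by_contra h3
    exact Nat.find_min hex h2 ⟨h1, h3⟩
  obtain ⟨m, hm⟩ : ∃ m, Nat.find hex = m + 1 := Nat.exists_eq_add_one.mpr (by omega)
  rw [hm] at hlt hne hmin
  have hnm : n < m := by
    rcases Nat.lt_or_ge n m with h1 | h1
    · exact h1
    · have : m = n := by omega
      subst this
      exact absurd dotVec_crossVec_right hne
  have hperp : ∀ k, n ≤ k → k ≤ m → dotVec (P k) (jumpVec P n) = 0 := by
    intro k h1 h2
    rcases h1.eq_or_lt with rfl | h1
    · exact dotVec_crossVec_left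
    · exact hmin k h1 (by omega)
  have h2n := h.two_le
  have hmn : n₀ ≤ m := by omega
  have hm0 := h.ne_zero hmn
  have hanti : ∀ i j, n₀ ≤ i → i ≤ j → |quadVal ζ (P j)| ≤ |quadVal ζ (P i)| := by
    intro i j h1 h2
    exact (h.isMinPt i (by omega)).antitone (h.isMinPt j (by omega)) h2
  have hX : n + 1 ≤ hgt (P m) := by
    by_contra! hlt'
    apply hjump
    apply crossVec_eq_zero_of_abs_quadVal_eq hT
    apply le_antisymm _ (hanti n (n + 1) hn (by omega))
    exact ((h.isMinPt n (by omega)).2.2 (P m) hm0 (by omega)).trans (hanti (n + 1) m (by omega) hnm)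
  have hXm := h.hgt_le hmn
  have hX0 : 1 ≤ hgt (P m) := by omega
  have hpar : ∀ W : Fin 3 → ℤ, dotVec W (jumpVec P n) = 0 →
      crossVec (jumpVec P n) (crossVec W (P m)) = 0 := fun W hW =>
    crossVec_parallel_symm (crossVec_crossVec_of_dotVec hW (hperp m hnm.le le_rfl))
  have hcross : ∀ k, n ≤ k → hgt (P k) < hgt (P m) → k ≤ m → crossVec (P k) (P m) ≠ 0 :=
    fun k h1 h2 h3 => crossVec_ne_zero_of_hgt_lt hT (h.ne_zero (by omega)) h2
      (hanti k m (by omega) h3)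
  obtain ⟨X, hXe⟩ : ∃ X, hgt (P m) = X + 1 := Nat.exists_eq_add_one.mpr (by omega)
  have hnX : n ≤ X := by omega
  have hWlt : hgt (P X) < hgt (P m) := by
    have := h.hgt_le (show n₀ ≤ X by omega)
    omega
  have hWne := hcross X hnX hWlt (by omega)
  have hWpar := hpar (P X) (hperp X hnX (by omega))
  set α := log (hgt (P m) : ℝ) with hα
  have hWh : HtLe (P X) (exp α) := htLe_exp_log hX0 hWlt.le
  have hmh : HtLe (P m) (exp α) := h.htLe hmn
  have hWv : |quadVal ζ (P X)| ≤ exp (3 - η * α) := by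
    have := h.val_le_succ (show n₀ ≤ X by omega)
    rwa [← hXe] at this
  have hmv : |quadVal ζ (P m)| ≤ exp (3 - η * α) := (hanti X m (by omega) (by omega)).trans hWv
  have herr := errLe_crossVec_exp hWh hmh hWv hmv le_rfl le_rfl
  have hht := htLe_crossVec_exp hWh hmh
  have hαβ : α ≤ log ((m + 1 : ℕ) : ℝ) := h.log_hgt_le hmn
  refine ⟨m, hnm, ?_, hX, ?_, ?_, ?_⟩
  · intro h0
    exact hne (dotVec_eq_zero_of_parallel_left hm0 h0 (hperp m hnm.le le_rfl))
  · refine symDet_ne_zero_of_parallel (hcross n le_rfl ?_ hnm.le)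
      (hpar _ (hperp n le_rfl hnm.le)) hdet
    have := h.hgt_le hn
    omega
  · have := nonneg_of_parallel (h.htLe_jumpVec hn) herr hWpar hdet hWne
    linarith [logC_nonneg ζ]
  · have hdot : dotVec (P (m + 1)) (crossVec (P X) (P m)) ≠ 0 := by
      intro h0
      exact hne (dotVec_eq_zero_of_parallel hWne (crossVec_parallel_symm hWpar) h0)
    have := nonneg_of_dotVec_ne_zero (h.htLe_index (show n₀ ≤ m + 1 by omega)) hht herr
      (h.val_le (m + 1) (by omega))
      (u := log ((m + 1 : ℕ) : ℝ) + (α + (3 - η * α) + 1 + logC ζ))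
      (by nlinarith [h.le_eta, logC_nonneg ζ]) le_rfl hdot
    linarith

/-- The sequence of turning points produced by the minimal points. -/
theorem exists_turning (hT : QuadIndep ζ) (hG : LinGood ζ (9 / 10)) (h1 : 13 / 5 ≤ η)
    (h2 : η ≤ 3) (hU : UnifExp ζ η) : ∃ C : ℝ, 0 ≤ C ∧ ∀ K : ℝ, ∃ (R : ℕ → Fin 3 → ℤ)
    (α β : ℕ → ℝ), ∀ k, K ≤ β k ∧ HtLe (R k) (exp (α k)) ∧ β k ≤ α (k + 1) ∧
      (η - 2) * β k ≤ α k + C ∧ (η - 1) * α (k + 1) ≤ α k + β k + C ∧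
      (η - 1) * α (k + 1) ≤ β (k + 1) + C ∧ |quadVal ζ (R k)| ≤ exp (C - η * β k) ∧
      symDet (crossVec (R k) (R (k + 1))) ≠ 0 := by
  obtain ⟨n₀, hn₀, hv⟩ := hU.isMinPt_le
  have hex : ∀ n : ℕ, ∃ P : Fin 3 → ℤ, 1 ≤ n → IsMinPt ζ n P := by
    intro n
    by_cases hn : 1 ≤ n
    · obtain ⟨P, hP⟩ := exists_isMinPt ζ hn
      exact ⟨P, fun _ => hP⟩
    · exact ⟨0, fun h => absurd h hn⟩
  choose P hP using hex
  have h : MinSeq ζ η n₀ P := ⟨hn₀, h1, h2, hP, fun n hn => hv n _ hn (hP n (by omega))⟩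
  obtain ⟨N, hN, hdet⟩ := h.symDet_jumpVec_ne_zero hG
  have hL := logC_nonneg ζ
  refine ⟨6 + 2 * logC ζ, by linarith, fun K => ?_⟩
  obtain ⟨N', hN'⟩ := exists_log_gt K
  obtain ⟨m₀, hm₀, hj₀⟩ := h.exists_jump hT (max N N')
  let S := {n : ℕ // m₀ ≤ n ∧ jumpVec P n ≠ 0}
  have hnext : ∀ n : S, ∃ m : S, TurnRel ζ η P n m := by
    rintro ⟨n, hn, hj⟩
    obtain ⟨m, hm⟩ := h.exists_next hT (show n₀ ≤ n by omega) hj (hdet n (by omega) hj)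
    exact ⟨⟨m, by have := hm.lt; omega, hm.jump⟩, hm⟩
  choose f hf using hnext
  let Y : ℕ → S := fun k => Nat.rec ⟨m₀, le_rfl, hj₀⟩ (fun _ y => f y) k
  have hY : ∀ k : ℕ, TurnRel ζ η P (Y k).1 (Y (k + 1)).1 := fun k => hf (Y k)
  have hYn : ∀ k : ℕ, n₀ ≤ (Y k).1 := fun k => by have := (Y k).2.1; omega
  refine ⟨fun k => P (Y k).1, fun k => log (hgt (P (Y k).1)), fun k => log (((Y k).1 + 1 : ℕ) : ℝ),
    fun k => ⟨?_, h.htLe (hYn k), ?_, ?_, (hY k).le_left, (hY k).le_right, ?_, (hY k).det⟩⟩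
  · exact (hN' _ (by have := (Y k).2.1; omega)).le
  · exact log_nat_mono (by omega) (hY k).succ_le_hgt
  · have hx := h.htLe_jumpVec (hYn k)
    have he := h.errLe_jumpVec (hYn k)
    have hd := hdet (Y k).1 (by have := (Y k).2.1; omega) (Y k).2.2
    have := nonneg_of_one_le_two_mul (one_le_symDet hx he hd)
    linarith
  · refine (h.val_le_succ (hYn k)).trans (exp_le_exp.mpr ?_)
    linarith

end Chain

/-- A chain of quadratic forms with Fibonacci growth and small values at `ζ`. -/
structure FibChain (ζ δ K : ℝ) (R : ℕ → Fin 3 → ℤ) (a : ℕ → ℝ) : Prop where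
  le : ∀ k, K ≤ a k
  growth : ∀ k, 3 / 2 * a k ≤ a (k + 1)
  growth_le : ∀ k, a (k + 1) ≤ 7 / 4 * a k
  fib : ∀ k, |a (k + 2) - a (k + 1) - a k| ≤ δ * a k
  htLe : ∀ k, HtLe (R k) (Real.exp (a k))
  val_le : ∀ k, |quadVal ζ (R k)| ≤ Real.exp (-(a k + 2 * a (k + 1)) + δ * a k)
  det : ∀ k, symDet (crossVec (R k) (R (k + 1))) ≠ 0

section Golden

open Real

theorem golden_step {g e C x b y : ℝ} (hg : g ^ 2 = g + 1) (hg1 : 1.618 < g) (hg2 : g < 1.619)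
    (he : 0 < e) (he' : e ≤ 1 / 1000) (hC : C ≤ e * x) (hx : 0 ≤ x)
    (h1 : (g - 1 - e) * b ≤ x + C) (h3 : (g - e) * y ≤ x + b + C) (h4 : (g - e) * x ≤ b + C) :
    (g - 2 * e) * x ≤ b ∧ y ≤ (g + 20 * e) * x := by
  have hb : b ≤ (g + 10 * e) * x := by
    have h5 : (g - 1 - e) * b ≤ (g - 1 - e) * ((g + 10 * e) * x) := by
      refine h1.trans ?_
      have : 1 + e ≤ (g - 1 - e) * (g + 10 * e) := by nlinarith
      nlinarith
    exact le_of_mul_le_mul_left h5 (by linarith)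
  refine ⟨by linarith, ?_⟩
  have h5 : (g - e) * y ≤ (g - e) * ((g + 20 * e) * x) := by
    refine h3.trans ?_
    have : 1 + g + 11 * e ≤ (g - e) * (g + 20 * e) := by nlinarith
    nlinarith
  exact le_of_mul_le_mul_left h5 (by linarith)

theorem exists_fibChain {ζ : ℝ} (hT : QuadIndep ζ)
    (hU : ∀ η < (3 + √5) / 2, UnifExp ζ η) {δ : ℝ} (hδ : 0 < δ) (K : ℝ) :
    ∃ R a, FibChain ζ δ K R a := by
  have h5 : √5 ^ 2 = 5 := Real.sq_sqrt (by norm_num)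
  have h50 : 0 ≤ √5 := Real.sqrt_nonneg 5
  have h51 : 2.236 < √5 := by rw [Real.lt_sqrt] <;> norm_num
  have h52 : √5 < 2.237 := by rw [Real.sqrt_lt'] <;> norm_num
  obtain ⟨g, hgdef⟩ : ∃ g, g = (1 + √5) / 2 := ⟨_, rfl⟩
  have hg : g ^ 2 = g + 1 := by rw [hgdef]; linear_combination h5 / 4
  have hg1 : 1.618 < g := by rw [hgdef]; linarith
  have hg2 : g < 1.619 := by rw [hgdef]; linarith
  obtain ⟨e, he, he', heδ⟩ : ∃ e : ℝ, 0 < e ∧ e ≤ 1 / 1000 ∧ 100 * e ≤ δ :=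
    ⟨min (δ / 100) (1 / 1000), by positivity, min_le_right _ _, by
      have := min_le_left (δ / 100) (1 / 1000); linarith⟩
  have hG := linGood_nine_tenths hT (hU (13 / 5) (by linarith))
  obtain ⟨C, hC0, hC⟩ := exists_turning (η := g + 1 - e) hT hG (by linarith) (by linarith)
    (hU _ (by linarith))
  have hm0 : 0 ≤ max K (C / e) := (by positivity : 0 ≤ C / e).trans (le_max_right _ _)
  obtain ⟨R, α, β, h⟩ := hC (2 * (C + max K (C / e)))
  have hα : ∀ k, max K (C / e) ≤ α k := by
    intro k
    obtain ⟨h1, -, -, h2, -⟩ := h k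
    nlinarith
  have hα0 : ∀ k, 0 ≤ α k := fun k => hm0.trans (hα k)
  have hCα : ∀ k, C ≤ e * α k := by
    intro k
    have := (le_max_right K (C / e)).trans (hα k)
    rw [div_le_iff₀ he] at this
    linarith
  have step : ∀ k, (g - 2 * e) * α (k + 1) ≤ β (k + 1) ∧ β (k + 1) ≤ α (k + 2) ∧
      α (k + 2) ≤ (g + 20 * e) * α (k + 1) := by
    intro k
    obtain ⟨-, -, -, -, -, h4, -⟩ := h k
    obtain ⟨-, -, h2, h1, h3, -⟩ := h (k + 1)
    have := golden_step (b := β (k + 1)) (y := α (k + 2)) hg hg1 hg2 he he' (hCα (k + 1))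
      (hα0 (k + 1)) (by linarith) (by linarith) (by linarith)
    exact ⟨this.1, h2, this.2⟩
  refine ⟨fun k => R (k + 1), fun k => α (k + 1), fun k => ?_, fun k => ?_, fun k => ?_,
    fun k => ?_, fun k => (h (k + 1)).2.1, fun k => ?_, fun k => (h (k + 1)).2.2.2.2.2.2.2⟩
  · exact (le_max_left _ _).trans (hα (k + 1))
  · obtain ⟨h1, h2, -⟩ := step k
    nlinarith [hα0 (k + 1)]
  · obtain ⟨-, -, h3⟩ := step k
    refine h3.trans (mul_le_mul_of_nonneg_right ?_ (hα0 (k + 1)))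
    linarith
  · obtain ⟨h1, h2, h3⟩ := step k
    obtain ⟨h1', h2', h3'⟩ := step (k + 1)
    have hx := hα0 (k + 1)
    have hex : 100 * e * α (k + 1) ≤ δ * α (k + 1) := mul_le_mul_of_nonneg_right heδ hx
    have hy : e * α (k + 2) ≤ 2 * (e * α (k + 1)) := by nlinarith [mul_nonneg he.le hx]
    show |α (k + 3) - α (k + 2) - α (k + 1)| ≤ δ * α (k + 1)
    have hd1 : α (k + 3) ≤ g * α (k + 2) + 20 * (e * α (k + 2)) := by
      have : α (k + 3) = α (k + 1 + 2) := rfl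
      linarith
    have hd2 : g * α (k + 2) - 2 * (e * α (k + 2)) ≤ α (k + 3) := by
      have : α (k + 3) = α (k + 1 + 2) := rfl
      have : α (k + 2) = α (k + 1 + 1) := rfl
      linarith
    have hlo : (g - 1) * ((g - 2 * e) * α (k + 1)) ≤ (g - 1) * α (k + 2) :=
      mul_le_mul_of_nonneg_left (h1.trans h2) (by linarith)
    have hhi : (g - 1) * α (k + 2) ≤ (g - 1) * ((g + 20 * e) * α (k + 1)) :=
      mul_le_mul_of_nonneg_left h3 (by linarith)
    have hg3 : (g - 1) * g = 1 := by linear_combination hg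
    have hlo' : (g - 1) * ((g - 2 * e) * α (k + 1))
        = α (k + 1) - 2 * ((g - 1) * (e * α (k + 1))) := by
      linear_combination α (k + 1) * hg3
    have hhi' : (g - 1) * ((g + 20 * e) * α (k + 1))
        = α (k + 1) + 20 * ((g - 1) * (e * α (k + 1))) := by
      linear_combination α (k + 1) * hg3
    have hm := mul_nonneg he.le hx
    have hm1 : (g - 1) * (e * α (k + 1)) ≤ e * α (k + 1) := by nlinarith
    rw [abs_le]
    constructor <;> linarith
  · obtain ⟨h1, h2, h3⟩ := step k
    refine (h (k + 1)).2.2.2.2.2.2.1.trans (exp_le_exp.mpr ?_)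
    show C - (g + 1 - e) * β (k + 1) ≤ -(α (k + 1) + 2 * α (k + 2)) + δ * α (k + 1)
    have hx := hα0 (k + 1)
    have hm := mul_nonneg he.le hx
    have hex : 100 * e * α (k + 1) ≤ δ * α (k + 1) := mul_le_mul_of_nonneg_right heδ hx
    have hb : (g + 1 - e) * ((g - 2 * e) * α (k + 1)) ≤ (g + 1 - e) * β (k + 1) :=
      mul_le_mul_of_nonneg_left h1 (by linarith)
    have hb' : (g + 1 - e) * ((g - 2 * e) * α (k + 1)) = (2 * g + 1) * α (k + 1)
        - (3 * g + 2 - 2 * e) * (e * α (k + 1)) := by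
      linear_combination α (k + 1) * hg
    have hm1 : (3 * g + 2 - 2 * e) * (e * α (k + 1)) ≤ 7 * (e * α (k + 1)) :=
      mul_le_mul_of_nonneg_right (by linarith) hm
    linarith [hCα (k + 1)]

end Golden

/-- The symmetric matrix with entries given by `z`. -/
def symMat (z : Fin 3 → ℤ) : Matrix (Fin 2) (Fin 2) ℤ := !![z 0, z 1; z 1, z 2]

/-- The adjugate of `symMat z`. -/
def adjMat (z : Fin 3 → ℤ) : Matrix (Fin 2) (Fin 2) ℤ := !![z 2, -z 1; -z 1, z 0]

/-- The bilinear form attached to `adjMat w`. -/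
def adjForm (w : Fin 3 → ℤ) (r₀ r₁ s₀ s₁ : ℝ) : ℝ :=
  w 2 * (r₀ * s₀) - w 1 * (r₀ * s₁ + r₁ * s₀) + w 0 * (r₁ * s₁)

/-- The entries of the symmetric matrix `symMat z * adjMat w * symMat z`. -/
def sandwich (z w : Fin 3 → ℤ) : Fin 3 → ℤ :=
  ![w 2 * (z 0 * z 0) - w 1 * (z 0 * z 1 + z 1 * z 0) + w 0 * (z 1 * z 1),
    w 2 * (z 0 * z 1) - w 1 * (z 0 * z 2 + z 1 * z 1) + w 0 * (z 1 * z 2),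
    w 2 * (z 1 * z 1) - w 1 * (z 1 * z 2 + z 2 * z 1) + w 0 * (z 2 * z 2)]

section Symmetric

open Real Matrix

variable {ζ : ℝ} {z w x y : Fin 3 → ℤ} {A B E F G : ℝ}

theorem symMat_mul_adjMat (z : Fin 3 → ℤ) : symMat z * adjMat z = symDet z • 1 := by
  ext i j
  fin_cases i <;> fin_cases j <;> simp [symMat, adjMat, symDet, Matrix.mul_apply] <;> ring

theorem adjMat_mul_symMat (z : Fin 3 → ℤ) : adjMat z * symMat z = symDet z • 1 := by
  ext i j
  fin_cases i <;> fin_cases j <;> simp [symMat, adjMat, symDet, Matrix.mul_apply] <;> ring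

theorem transpose_symMat (z : Fin 3 → ℤ) : (symMat z)ᵀ = symMat z := by
  ext i j
  fin_cases i <;> fin_cases j <;> simp [symMat]

theorem transpose_adjMat (z : Fin 3 → ℤ) : (adjMat z)ᵀ = adjMat z := by
  ext i j
  fin_cases i <;> fin_cases j <;> simp [adjMat]

theorem det_symMat (z : Fin 3 → ℤ) : (symMat z).det = symDet z := by
  simp [symMat, symDet, Matrix.det_fin_two]; ring

theorem det_adjMat (z : Fin 3 → ℤ) : (adjMat z).det = symDet z := by
  simp [adjMat, symDet, Matrix.det_fin_two]; ring

theorem symMat_sandwich (z w : Fin 3 → ℤ) :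
    symMat (sandwich z w) = symMat z * adjMat w * symMat z := by
  ext i j
  fin_cases i <;> fin_cases j <;>
    simp [symMat, adjMat, sandwich, Matrix.mul_apply] <;> ring

theorem symDet_sandwich (z w : Fin 3 → ℤ) :
    symDet (sandwich z w) = symDet z ^ 2 * symDet w := by
  rw [← det_symMat, symMat_sandwich, Matrix.det_mul, Matrix.det_mul, det_symMat, det_adjMat]
  ring

theorem symMat_smul (s : ℤ) (z : Fin 3 → ℤ) : symMat (s • z) = s • symMat z := by
  ext i j
  fin_cases i <;> fin_cases j <;> simp [symMat]

theorem exists_smul_eq_of_parallel (hx : x ≠ 0) (hy : y ≠ 0) (h : crossVec x y = 0) :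
    ∃ s t : ℤ, s ≠ 0 ∧ t ≠ 0 ∧ s • x = t • y := by
  rw [crossVec_eq_zero_iff] at h
  obtain ⟨i, hi⟩ := exists_ne_zero_of_ne_zero hx
  obtain ⟨j, hj⟩ := exists_ne_zero_of_ne_zero hy
  refine ⟨y i, x i, ?_, hi, ?_⟩
  · intro h0
    have := h i j
    rw [h0, mul_zero] at this
    exact mul_ne_zero hi hj this
  · ext k
    simp only [Pi.smul_apply, smul_eq_mul]
    linarith [h k i]

theorem abs_adjForm_le (hw : HtLe w A) (he : ErrLe ζ w E) {r₀ r₁ s₀ s₁ r ρ s σ : ℝ}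
    (hr : |r₀| ≤ r) (hs : |s₀| ≤ s) (hρ : |ζ * r₀ - r₁| ≤ ρ) (hσ : |ζ * s₀ - s₁| ≤ σ) :
    |adjForm w r₀ r₁ s₀ s₁| ≤ (1 + |ζ|) * E * (r * s) + E * (r * σ) + E * (ρ * s)
      + A * (ρ * σ) := by
  have e : adjForm w r₀ r₁ s₀ s₁ = (ζ * (ζ * w 0 - w 1) - (ζ * w 1 - w 2)) * (r₀ * s₀)
      - (ζ * w 0 - w 1) * (r₀ * (ζ * s₀ - s₁)) - (ζ * w 0 - w 1) * ((ζ * r₀ - r₁) * s₀)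
      + w 0 * ((ζ * r₀ - r₁) * (ζ * s₀ - s₁)) := by
    simp only [adjForm]; ring
  rw [e]
  have hA := hw.nonneg
  have hE := he.nonneg
  have hr0 := (abs_nonneg _).trans hr
  have hs0 := (abs_nonneg _).trans hs
  have hρ0 := (abs_nonneg _).trans hρ
  have hσ0 := (abs_nonneg _).trans hσ
  have h0 : |ζ * (ζ * w 0 - w 1) - (ζ * w 1 - w 2)| ≤ (1 + |ζ|) * E := by
    refine (abs_sub _ _).trans ?_
    rw [abs_mul]
    have := mul_le_mul_of_nonneg_left he.1 (abs_nonneg ζ)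
    linarith [he.2]
  refine (abs_add_le _ _).trans (add_le_add ((abs_sub _ _).trans (add_le_add
    ((abs_sub _ _).trans (add_le_add ?_ ?_)) ?_)) ?_) <;> rw [abs_mul, abs_mul] <;> gcongr
  · exact he.1
  · exact he.1
  · exact hw 0

theorem htLe_sandwich (hz : HtLe z A) (hze : ErrLe ζ z E) (hw : HtLe w B) (hwe : ErrLe ζ w F) :
    HtLe (sandwich z w) ((1 + |ζ|) * F * (A * A) + F * (A * E) + F * (E * A) + B * (E * E)) := by
  intro i
  have key : ∀ i j : Fin 2, |adjForm w (![(z 0 : ℝ), z 1] i) (![(z 1 : ℝ), z 2] i)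
      (![(z 0 : ℝ), z 1] j) (![(z 1 : ℝ), z 2] j)| ≤
      (1 + |ζ|) * F * (A * A) + F * (A * E) + F * (E * A) + B * (E * E) := by
    intro i j
    refine abs_adjForm_le hw hwe ?_ ?_ ?_ ?_
    · fin_cases i; exacts [hz 0, hz 1]
    · fin_cases j; exacts [hz 0, hz 1]
    · fin_cases i; exacts [hze.1, hze.2]
    · fin_cases j; exacts [hze.1, hze.2]
  fin_cases i
  · simpa [sandwich, adjForm] using key 0 0
  · simpa [sandwich, adjForm] using key 0 1
  · simpa [sandwich, adjForm] using key 1 1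

theorem errLe_sandwich (hz : HtLe z A) (hze : ErrLe ζ z E) (hw : HtLe w B)
    (hwe : ErrLe ζ w F) : ErrLe ζ (sandwich z w) ((1 + |ζ|) * F * (A * E)
      + F * (A * ((1 + |ζ|) * E)) + F * (E * E) + B * (E * ((1 + |ζ|) * E))) := by
  have hE := hze.nonneg
  have hσ : |ζ * (ζ * z 0 - z 1) - (ζ * z 1 - z 2)| ≤ (1 + |ζ|) * E := by
    refine (abs_sub _ _).trans ?_
    rw [abs_mul]
    have := mul_le_mul_of_nonneg_left hze.1 (abs_nonneg ζ)
    linarith [hze.2]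
  constructor
  · have e : ζ * (sandwich z w 0 : ℝ) - (sandwich z w 1 : ℝ)
        = adjForm w (z 0) (z 1) (ζ * z 0 - z 1) (ζ * z 1 - z 2) := by
      simp [sandwich, adjForm]; ring
    rw [e]
    exact abs_adjForm_le hw hwe (hz 0) hze.1 hze.1 hσ
  · have e : ζ * (sandwich z w 1 : ℝ) - (sandwich z w 2 : ℝ)
        = adjForm w (z 1) (z 2) (ζ * z 0 - z 1) (ζ * z 1 - z 2) := by
      simp [sandwich, adjForm]; ring
    rw [e]
    exact abs_adjForm_le hw hwe (hz 1) hze.1 hze.2 hσ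

end Symmetric

section ChainBounds

open Real

variable {ζ δ K : ℝ} {R : ℕ → Fin 3 → ℤ} {a : ℕ → ℝ}

/-- A chain starting so late that the absolute constants are absorbed. -/
structure LateChain (ζ δ K : ℝ) (R : ℕ → Fin 3 → ℤ) (a : ℕ → ℝ) : Prop extends
    FibChain ζ δ K R a where
  delta_pos : 0 < δ
  delta_le : δ ≤ 1 / 1000
  const_le : 20 * (1 + logC ζ) ≤ δ * K

theorem LateChain.pos (h : LateChain ζ δ K R a) (k : ℕ) : 0 < a k := by
  have h1 := h.const_le
  have h2 := logC_nonneg ζ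
  have h3 : 0 < δ * K := by linarith
  exact (pos_of_mul_pos_right h3 h.delta_pos.le).trans_le (h.le k)

theorem LateChain.const_le' (h : LateChain ζ δ K R a) (k : ℕ) :
    20 * (1 + logC ζ) ≤ δ * a k :=
  h.const_le.trans (mul_le_mul_of_nonneg_left (h.le k) h.delta_pos.le)

theorem LateChain.smul_le (h : LateChain ζ δ K R a) (k : ℕ) :
    δ * a (k + 1) ≤ 7 / 4 * (δ * a k) := by
  have := mul_le_mul_of_nonneg_left (h.growth_le k) h.delta_pos.le
  linarith

theorem LateChain.small (h : LateChain ζ δ K R a) (k : ℕ) : 1000 * (δ * a k) ≤ a k := by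
  have := mul_le_mul_of_nonneg_right h.delta_le (h.pos k).le
  linarith

theorem LateChain.htLe_jumpVec (h : LateChain ζ δ K R a) (k : ℕ) :
    HtLe (jumpVec R k) (exp (a k + a (k + 1) + 2 * (δ * a k))) := by
  refine (htLe_crossVec_exp (h.htLe k) (h.htLe (k + 1))).mono (exp_le_exp.mpr ?_)
  linarith [h.const_le' k, logC_nonneg ζ]

theorem LateChain.errLe_jumpVec (h : LateChain ζ δ K R a) (k : ℕ) :
    ErrLe ζ (jumpVec R k) (exp (-(a k + a (k + 1)) + 2 * (δ * a k))) := by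
  refine (errLe_crossVec_exp (h.htLe k) (h.htLe (k + 1)) (h.val_le k) (h.val_le (k + 1))
    (e := -(a k + a (k + 1)) + δ * a k) (by linarith) ?_).mono (exp_le_exp.mpr ?_)
  · have h1 := h.growth k
    have h2 : 3 / 2 * a (k + 1) ≤ a (k + 2) := h.growth (k + 1)
    have h3 := h.small (k + 1)
    have h4 := h.pos k
    have h5 : 0 < δ * a k := mul_pos h.delta_pos h4
    show a k + (-(a (k + 1) + 2 * a (k + 2)) + δ * a (k + 1)) ≤ _
    linarith
  · linarith [h.const_le' k, logC_nonneg ζ]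

theorem LateChain.det_jumpVec (h : LateChain ζ δ K R a) (k : ℕ) : symDet (jumpVec R k) ≠ 0 :=
  h.det k

theorem LateChain.abs_symDet_jumpVec_le (h : LateChain ζ δ K R a) (k : ℕ) :
    |(symDet (jumpVec R k) : ℝ)| ≤ exp (5 * (δ * a k)) := by
  refine (abs_symDet_le_exp (h.htLe_jumpVec k) (h.errLe_jumpVec k)).trans (exp_le_exp.mpr ?_)
  linarith [h.const_le' k, logC_nonneg ζ]

theorem ne_zero_of_symDet_ne_zero {x : Fin 3 → ℤ} (h : symDet x ≠ 0) : x ≠ 0 := by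
  rintro rfl
  exact h (by simp [symDet])

theorem four_le_exp_two : (4 : ℝ) ≤ exp 2 := by
  have := two_le_exp_one
  have h : exp 2 = exp 1 * exp 1 := by rw [← exp_add]; norm_num
  rw [h]; nlinarith

theorem sum_four_le_exp {ζ X t₁ t₂ t₃ t₄ : ℝ} (h₁ : t₁ ≤ (2 + |ζ|) * exp X)
    (h₂ : t₂ ≤ (2 + |ζ|) * exp X) (h₃ : t₃ ≤ (2 + |ζ|) * exp X)
    (h₄ : t₄ ≤ (2 + |ζ|) * exp X) : t₁ + t₂ + t₃ + t₄ ≤ exp (X + 2 + logC ζ) := by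
  rw [exp_add, exp_add, exp_logC]
  have h0 : 0 < (2 + |ζ|) * exp X := by positivity
  nlinarith [four_le_exp_two]

theorem le_mul_exp_of_le {ζ c X Y : ℝ} (hc : c ≤ 2 + |ζ|) (h : Y ≤ X) :
    c * exp Y ≤ (2 + |ζ|) * exp X := by
  have := exp_le_exp.mpr h
  gcongr

theorem LateChain.fib_bounds (h : LateChain ζ δ K R a) (k : ℕ) :
    a k + a (k + 1) - δ * a k ≤ a (k + 2) ∧ a (k + 2) ≤ a k + a (k + 1) + δ * a k := by
  have := abs_le.mp (h.fib k)
  constructor <;> linarith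

theorem htLe_sandwich_exp {z w : Fin 3 → ℤ} {S T D X : ℝ} (hz : HtLe z (exp (S + D)))
    (hze : ErrLe ζ z (exp (-S + D))) (hw : HtLe w (exp (T + D))) (hwe : ErrLe ζ w (exp (-T + D)))
    (h1 : 2 * S - T + 3 * D ≤ X) (h2 : -T + 3 * D ≤ X) (h3 : T - 2 * S + 3 * D ≤ X) :
    HtLe (sandwich z w) (exp (X + 2 + logC ζ)) := by
  refine (htLe_sandwich hz hze hw hwe).mono ?_
  have hz := abs_nonneg ζ
  refine sum_four_le_exp ?_ ?_ ?_ ?_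
  · rw [mul_assoc, ← exp_add, ← exp_add]
    exact le_mul_exp_of_le (by linarith) (by linarith)
  · rw [← exp_add, ← exp_add, ← one_mul (exp _)]
    exact le_mul_exp_of_le (by linarith) (by linarith)
  · rw [← exp_add, ← exp_add, ← one_mul (exp _)]
    exact le_mul_exp_of_le (by linarith) (by linarith)
  · rw [← exp_add, ← exp_add, ← one_mul (exp _)]
    exact le_mul_exp_of_le (by linarith) (by linarith)

theorem errLe_sandwich_exp {z w : Fin 3 → ℤ} {S T D X : ℝ} (hz : HtLe z (exp (S + D)))
    (hze : ErrLe ζ z (exp (-S + D))) (hw : HtLe w (exp (T + D))) (hwe : ErrLe ζ w (exp (-T + D)))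
    (h1 : -T - 2 * S + 3 * D ≤ X) (h2 : -T + 3 * D ≤ X) (h3 : T - 2 * S + 3 * D ≤ X) :
    ErrLe ζ (sandwich z w) (exp (X + 2 + logC ζ)) := by
  refine (errLe_sandwich hz hze hw hwe).mono ?_
  have hz := abs_nonneg ζ
  refine sum_four_le_exp ?_ ?_ ?_ ?_
  · rw [mul_assoc, ← exp_add, ← exp_add]
    exact le_mul_exp_of_le (by linarith) (by linarith)
  · rw [mul_left_comm (exp (S + D)), mul_left_comm, ← exp_add, ← exp_add]
    exact le_mul_exp_of_le (by linarith) (by linarith)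
  · rw [← exp_add, ← exp_add, ← one_mul (exp _)]
    exact le_mul_exp_of_le (by linarith) (by linarith)
  · rw [mul_left_comm (exp (-S + D)), mul_left_comm, ← exp_add, ← exp_add]
    exact le_mul_exp_of_le (by linarith) (by linarith)

/-- The key algebraic relation between the symmetric matrices attached to the chain. -/
theorem LateChain.sandwich_parallel (h : LateChain ζ δ K R a) (k : ℕ) :
    crossVec (jumpVec R k) (sandwich (jumpVec R (k + 2)) (jumpVec R (k + 3))) = 0 := by
  set v := δ * a k with hv
  have s1 := h.smul_le k
  have s2 : δ * a (k + 2) ≤ 7 / 4 * (δ * a (k + 1)) := h.smul_le (k + 1)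
  have s3 : δ * a (k + 3) ≤ 7 / 4 * (δ * a (k + 2)) := h.smul_le (k + 2)
  obtain ⟨f1, f1'⟩ := h.fib_bounds k
  obtain ⟨f2, f2'⟩ : a (k + 1) + a (k + 2) - δ * a (k + 1) ≤ a (k + 3) ∧
    a (k + 3) ≤ a (k + 1) + a (k + 2) + δ * a (k + 1) := h.fib_bounds (k + 1)
  obtain ⟨f3, f3'⟩ : a (k + 2) + a (k + 3) - δ * a (k + 2) ≤ a (k + 4) ∧
    a (k + 4) ≤ a (k + 2) + a (k + 3) + δ * a (k + 2) := h.fib_bounds (k + 2)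
  have p0 := h.pos k
  have p1 := h.pos (k + 1)
  have p2 := h.pos (k + 2)
  have g0 := h.growth k
  have g1 : 3 / 2 * a (k + 1) ≤ a (k + 2) := h.growth (k + 1)
  have c0 := h.const_le' k
  have m0 := h.small k
  have m1 := h.small (k + 1)
  have q0 : 0 < v := mul_pos h.delta_pos p0
  have hL := logC_nonneg ζ
  rw [← hv] at *
  have hz : HtLe (jumpVec R (k + 2)) (exp (a (k + 2) + a (k + 3) + 11 * v)) :=
    (h.htLe_jumpVec (k + 2)).mono (exp_le_exp.mpr (by
      show a (k + 2) + a (k + 3) + 2 * (δ * a (k + 2)) ≤ _; linarith))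
  have hze : ErrLe ζ (jumpVec R (k + 2)) (exp (-(a (k + 2) + a (k + 3)) + 11 * v)) :=
    (h.errLe_jumpVec (k + 2)).mono (exp_le_exp.mpr (by
      show -(a (k + 2) + a (k + 3)) + 2 * (δ * a (k + 2)) ≤ _; linarith))
  have hw : HtLe (jumpVec R (k + 3)) (exp (a (k + 3) + a (k + 4) + 11 * v)) :=
    (h.htLe_jumpVec (k + 3)).mono (exp_le_exp.mpr (by
      show a (k + 3) + a (k + 4) + 2 * (δ * a (k + 3)) ≤ _; linarith))
  have hwe : ErrLe ζ (jumpVec R (k + 3)) (exp (-(a (k + 3) + a (k + 4)) + 11 * v)) :=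
    (h.errLe_jumpVec (k + 3)).mono (exp_le_exp.mpr (by
      show -(a (k + 3) + a (k + 4)) + 2 * (δ * a (k + 3)) ≤ _; linarith))
  have hy := htLe_sandwich_exp (X := a k + a (k + 1) + 41 * v) hz hze hw hwe
    (by linarith) (by linarith) (by linarith)
  have hye := errLe_sandwich_exp (X := -(a k + a (k + 1)) + 41 * v) hz hze hw hwe
    (by linarith) (by linarith) (by linarith)
  apply crossVec_crossVec_of_dotVec
  · by_contra hne
    have := nonneg_of_dotVec_ne_zero (h.htLe k) hy hye (h.val_le k) (u := -a (k + 1) + 43 * v)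
      (by linarith) (by linarith) hne
    linarith
  · by_contra hne
    have := nonneg_of_dotVec_ne_zero (h.htLe (k + 1)) hy hye (h.val_le (k + 1))
      (u := -a k + 46 * v)
      (by show _ + (-(a (k + 1) + 2 * a (k + 2)) + δ * a (k + 1)) ≤ _; linarith)
      (by linarith) hne
    linarith

end ChainBounds

/-- The transition matrix attached to three consecutive members of a chain. -/
def transMat (R : ℕ → Fin 3 → ℤ) (k : ℕ) : Matrix (Fin 2) (Fin 2) ℤ :=
  symMat (jumpVec R k) * adjMat (jumpVec R (k + 2)) * symMat (jumpVec R (k + 1))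

section Descent

open Real Matrix

variable {ζ δ K θ : ℝ} {R : ℕ → Fin 3 → ℤ} {a : ℕ → ℝ}

theorem transpose_transMat (R : ℕ → Fin 3 → ℤ) (k : ℕ) : (transMat R k)ᵀ =
    symMat (jumpVec R (k + 1)) * adjMat (jumpVec R (k + 2)) * symMat (jumpVec R k) := by
  simp only [transMat, Matrix.transpose_mul, transpose_symMat, transpose_adjMat, Matrix.mul_assoc]

theorem LateChain.det_transMat_ne_zero (h : LateChain ζ δ K R a) (k : ℕ) :
    (transMat R k).det ≠ 0 := by
  simp only [transMat, Matrix.det_mul, det_symMat, det_adjMat]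
  exact mul_ne_zero (mul_ne_zero (h.det_jumpVec _) (h.det_jumpVec _)) (h.det_jumpVec _)

theorem LateChain.transMat_succ (h : LateChain ζ δ K R a) (k : ℕ) :
    ∃ s t : ℤ, s ≠ 0 ∧ t ≠ 0 ∧ s • (transMat R k)ᵀ = t • transMat R (k + 1) := by
  have hy : sandwich (jumpVec R (k + 2)) (jumpVec R (k + 3)) ≠ 0 := by
    apply ne_zero_of_symDet_ne_zero
    rw [symDet_sandwich]
    exact mul_ne_zero (pow_ne_zero 2 (h.det_jumpVec _)) (h.det_jumpVec _)
  obtain ⟨s, t, hs, ht, e⟩ := exists_smul_eq_of_parallel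
    (ne_zero_of_symDet_ne_zero (h.det_jumpVec k)) hy (h.sandwich_parallel k)
  refine ⟨s, t * symDet (jumpVec R (k + 2)), hs, mul_ne_zero ht (h.det_jumpVec _), ?_⟩
  have e' := congrArg symMat e
  rw [symMat_smul, symMat_smul, symMat_sandwich] at e'
  calc s • (transMat R k)ᵀ = symMat (jumpVec R (k + 1)) * adjMat (jumpVec R (k + 2)) *
        (s • symMat (jumpVec R k)) := by rw [transpose_transMat, Matrix.mul_smul]
    _ = t • (symMat (jumpVec R (k + 1)) * ((adjMat (jumpVec R (k + 2)) *
        symMat (jumpVec R (k + 2))) * adjMat (jumpVec R (k + 3)) * symMat (jumpVec R (k + 2)))) := by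
      rw [e', Matrix.mul_smul]
      simp only [Matrix.mul_assoc]
    _ = (t * symDet (jumpVec R (k + 2))) • transMat R (k + 1) := by
      rw [adjMat_mul_symMat, Matrix.smul_mul, Matrix.smul_mul, Matrix.mul_smul, Matrix.one_mul,
        smul_smul, transMat, Matrix.mul_assoc]

theorem LateChain.exists_smul_transMat (h : LateChain ζ δ K R a) (k : ℕ) :
    ∃ (s t : ℤ) (G : Matrix (Fin 2) (Fin 2) ℤ), s ≠ 0 ∧ t ≠ 0 ∧
      (G = transMat R 0 ∨ G = (transMat R 0)ᵀ) ∧ s • G = t • (transMat R k)ᵀ := by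
  induction k with
  | zero => exact ⟨1, 1, _, one_ne_zero, one_ne_zero, Or.inr rfl, rfl⟩
  | succ k ih =>
    obtain ⟨s, t, G, hs, ht, hG, e⟩ := ih
    obtain ⟨s', t', hs', ht', e'⟩ := h.transMat_succ k
    refine ⟨s' * s, t * t', Gᵀ, mul_ne_zero hs' hs, mul_ne_zero ht ht', ?_, ?_⟩
    · rcases hG with rfl | rfl
      · exact Or.inr rfl
      · exact Or.inl (Matrix.transpose_transpose _)
    · rw [← Matrix.transpose_smul, mul_smul, e, smul_comm, e', ← Matrix.transpose_smul, smul_smul]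

theorem abs_le_of_sq_mul_eq {s t f g : ℤ} (hf : f ≠ 0) (hg : g ≠ 0)
    (h : s ^ 2 * g = t ^ 2 * f) : |t| ≤ |g| * |s| := by
  have h2 := Int.one_le_abs hf
  have h3 := Int.one_le_abs hg
  have h4 : |s| ^ 2 * |g| = |t| ^ 2 * |f| := by
    rw [← abs_pow, ← abs_mul, h, abs_mul, abs_pow]
  have h5 : |t| ^ 2 ≤ |t| ^ 2 * |f| := le_mul_of_one_le_right (sq_nonneg _) h2
  have h6 : |s| ^ 2 * |g| ≤ |s| ^ 2 * (|g| * |g|) :=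
    mul_le_mul_of_nonneg_left (le_mul_of_one_le_right (abs_nonneg _) h3) (sq_nonneg _)
  refine abs_le_of_sq_le_sq' ?_ (by positivity) |>.2
  calc |t| ^ 2 ≤ |s| ^ 2 * (|g| * |g|) := by linarith
    _ = (|g| * |s|) ^ 2 := by ring

theorem LateChain.exists_transfer (h : LateChain ζ δ K R a) (k : ℕ) (u : Fin 2 → ℤ)
    (hu : u ≠ 0) : ∃ (s t : ℤ) (G : Matrix (Fin 2) (Fin 2) ℤ), s ≠ 0 ∧
      (G = transMat R 0 ∨ G = (transMat R 0)ᵀ) ∧ |t| ≤ |(transMat R 0).det| * |s| ∧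
      G *ᵥ (adjMat (jumpVec R k) *ᵥ u) ≠ 0 ∧
      s • (G *ᵥ (adjMat (jumpVec R k) *ᵥ u)) = (t * symDet (jumpVec R k)) •
        (symMat (jumpVec R (k + 1)) *ᵥ (adjMat (jumpVec R (k + 2)) *ᵥ u)) := by
  obtain ⟨s, t, G, hs, ht, hG, e⟩ := h.exists_smul_transMat k
  have hdet : G.det = (transMat R 0).det := by
    rcases hG with rfl | rfl
    · rfl
    · exact Matrix.det_transpose _
  refine ⟨s, t, G, hs, hG, ?_, ?_, ?_⟩
  · have h1 := congrArg Matrix.det e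
    rw [Matrix.det_smul, Matrix.det_smul, Matrix.det_transpose, Fintype.card_fin, hdet] at h1
    exact abs_le_of_sq_mul_eq (h.det_transMat_ne_zero k) (h.det_transMat_ne_zero 0) h1
  · intro h0
    have h1 := Matrix.eq_zero_of_mulVec_eq_zero (hdet ▸ h.det_transMat_ne_zero 0) h0
    refine hu (Matrix.eq_zero_of_mulVec_eq_zero ?_ h1)
    rw [det_adjMat]
    exact h.det_jumpVec k
  · rw [← Matrix.smul_mulVec, e, Matrix.smul_mulVec, Matrix.mulVec_mulVec, transpose_transMat,
      Matrix.mul_assoc, symMat_mul_adjMat, Matrix.mul_smul, Matrix.mul_one, Matrix.smul_mulVec,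
      smul_smul, Matrix.mulVec_mulVec]

theorem abs_adjMat_mulVec_le {z : Fin 3 → ℤ} {u : Fin 2 → ℤ} {A E m e : ℝ} (hz : HtLe z A)
    (hze : ErrLe ζ z E) (hu : |(u 0 : ℝ)| ≤ m) (he : |ζ * u 0 - u 1| ≤ e) (i : Fin 2) :
    |((adjMat z *ᵥ u) i : ℝ)| ≤ m * E + A * e := by
  fin_cases i
  · have : ((adjMat z *ᵥ u) 0 : ℝ) = z 1 * (ζ * u 0 - u 1) - u 0 * (ζ * z 1 - z 2) := by
      simp [adjMat, Matrix.mulVec, dotProduct, Fin.sum_univ_two]; ring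
    show |((adjMat z *ᵥ u) 0 : ℝ)| ≤ _
    rw [this, add_comm]
    exact abs_mul_sub_mul_le (hz 1) he hu hze.2
  · have : ((adjMat z *ᵥ u) 1 : ℝ) = u 0 * (ζ * z 0 - z 1) - z 0 * (ζ * u 0 - u 1) := by
      simp [adjMat, Matrix.mulVec, dotProduct, Fin.sum_univ_two]; ring
    show |((adjMat z *ᵥ u) 1 : ℝ)| ≤ _
    rw [this]
    exact abs_mul_sub_mul_le hu hze.1 (hz 0) he

theorem abs_mulVec_le {G : Matrix (Fin 2) (Fin 2) ℤ} {w : Fin 2 → ℤ} {A m : ℝ}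
    (hG : ∀ i j, |(G i j : ℝ)| ≤ A) (hw : ∀ i, |(w i : ℝ)| ≤ m) (i : Fin 2) :
    |((G *ᵥ w) i : ℝ)| ≤ 2 * (A * m) := by
  have : ((G *ᵥ w) i : ℝ) = G i 0 * w 0 + G i 1 * w 1 := by
    simp [Matrix.mulVec, dotProduct, Fin.sum_univ_two]
  rw [this, two_mul]
  have hA := (abs_nonneg _).trans (hG 0 0)
  refine (abs_add_le _ _).trans (add_le_add ?_ ?_) <;> rw [abs_mul] <;> gcongr
  exacts [hG i 0, hw 0, hG i 1, hw 1]

theorem abs_lin_symMat_mulVec_le {z : Fin 3 → ℤ} {w : Fin 2 → ℤ} {E m : ℝ}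
    (hze : ErrLe ζ z E) (hw : ∀ i, |(w i : ℝ)| ≤ m) :
    |ζ * ((symMat z *ᵥ w) 0 : ℝ) - ((symMat z *ᵥ w) 1 : ℝ)| ≤ 2 * (E * m) := by
  have : ζ * ((symMat z *ᵥ w) 0 : ℝ) - ((symMat z *ᵥ w) 1 : ℝ)
      = (ζ * z 0 - z 1) * w 0 + (ζ * z 1 - z 2) * w 1 := by
    simp [symMat, Matrix.mulVec, dotProduct, Fin.sum_univ_two]; ring
  rw [this, two_mul]
  have hE := hze.nonneg
  refine (abs_add_le _ _).trans (add_le_add ?_ ?_) <;> rw [abs_mul] <;> gcongr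
  exacts [hze.1, hw 0, hze.2, hw 1]

theorem exists_exp_bound (G : Matrix (Fin 2) (Fin 2) ℤ) : ∃ Γ : ℝ, 0 ≤ Γ ∧
    (∀ i j, |(G i j : ℝ)| ≤ exp Γ) ∧ |(G.det : ℝ)| ≤ exp Γ := by
  set Γ : ℝ := (∑ i, ∑ j, |(G i j : ℝ)|) + |(G.det : ℝ)| with hΓ
  have h1 := Real.add_one_le_exp Γ
  have h0 : 0 ≤ ∑ i, ∑ j, |(G i j : ℝ)| := by positivity
  refine ⟨Γ, by positivity, fun i j => ?_, ?_⟩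
  · have h2 : |(G i j : ℝ)| ≤ ∑ i, ∑ j, |(G i j : ℝ)| :=
      (Finset.single_le_sum (f := fun j => |(G i j : ℝ)|) (fun _ _ => abs_nonneg _)
        (Finset.mem_univ j)).trans
      (Finset.single_le_sum (f := fun i => ∑ j, |(G i j : ℝ)|)
        (fun _ _ => Finset.sum_nonneg fun _ _ => abs_nonneg _) (Finset.mem_univ i))
    linarith [abs_nonneg (G.det : ℝ)]
  · linarith

theorem LateChain.geometric (h : LateChain ζ δ K R a) (k : ℕ) : (3 / 2) ^ k * a 0 ≤ a k := by
  induction k with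
  | zero => simp
  | succ k ih => rw [pow_succ]; linarith [h.growth k]

theorem LateChain.exists_lt (h : LateChain ζ δ K R a) (s : ℝ) : ∃ k, s < a k := by
  obtain ⟨n, hn⟩ := pow_unbounded_of_one_lt (s / a 0) (by norm_num : (1 : ℝ) < 3 / 2)
  refine ⟨n, ?_⟩
  rw [div_lt_iff₀ (h.pos 0)] at hn
  exact hn.trans_le (h.geometric n)

theorem exists_le_and_lt_succ {b : ℕ → ℝ} {s : ℝ} (h0 : b 0 ≤ s) (h : ∃ k, s < b k) :
    ∃ k, b k ≤ s ∧ s < b (k + 1) := by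
  classical
  obtain ⟨k, hk⟩ : ∃ k, Nat.find h = k + 1 := by
    apply Nat.exists_eq_add_one.mpr
    rw [Nat.pos_iff_ne_zero]
    intro h1
    have := Nat.find_spec h
    rw [h1] at this
    linarith
  refine ⟨k, not_lt.mp (Nat.find_min h (by omega)), ?_⟩
  rw [← hk]
  exact Nat.find_spec h

end Descent

section DescentStep

open Real Matrix

variable {ζ δ K θ : ℝ} {R : ℕ → Fin 3 → ℤ} {a : ℕ → ℝ}

theorem abs_adjMat_mulVec_le_exp {z : Fin 3 → ℤ} {u : Fin 2 → ℤ} {A E m e X : ℝ}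
    (hz : HtLe z (exp A)) (hze : ErrLe ζ z (exp E)) (hu : |(u 0 : ℝ)| ≤ exp m)
    (he : |ζ * u 0 - u 1| ≤ exp e) (h1 : m + E ≤ X) (h2 : A + e ≤ X) (i : Fin 2) :
    |((adjMat z *ᵥ u) i : ℝ)| ≤ 2 * exp X := by
  refine (abs_adjMat_mulVec_le hz hze hu he i).trans ?_
  rw [← exp_add, ← exp_add, two_mul]
  exact add_le_add (exp_le_exp.mpr h1) (exp_le_exp.mpr h2)

theorem two_mul_exp_mul_two_mul_exp_le (x y : ℝ) :
    2 * (exp x * (2 * exp y)) ≤ exp (2 + x + y) := by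
  rw [exp_add, exp_add]
  nlinarith [four_le_exp_two, mul_pos (exp_pos x) (exp_pos y)]

theorem abs_lin_transfer_le {z z' : Fin 3 → ℤ} {w u' : Fin 2 → ℤ} {s t : ℤ} {Γ D E M : ℝ}
    (hs : s ≠ 0) (ht : |(t : ℝ)| ≤ exp Γ * |(s : ℝ)|) (hD : |(symDet z : ℝ)| ≤ exp D)
    (hE : ErrLe ζ z' (exp E)) (hw : ∀ i, |(w i : ℝ)| ≤ 2 * exp M)
    (e : s • u' = (t * symDet z) • (symMat z' *ᵥ w)) :
    |ζ * u' 0 - u' 1| ≤ exp (Γ + D + (2 + E + M)) := by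
  have hs' : 0 < |(s : ℝ)| := abs_pos.mpr (by exact_mod_cast hs)
  have hl := (abs_lin_symMat_mulVec_le hE hw).trans (two_mul_exp_mul_two_mul_exp_le _ _)
  have e0 : (s : ℝ) * u' 0 = t * symDet z * ((symMat z' *ᵥ w) 0 : ℝ) := by
    exact_mod_cast congrFun e 0
  have e1 : (s : ℝ) * u' 1 = t * symDet z * ((symMat z' *ᵥ w) 1 : ℝ) := by
    exact_mod_cast congrFun e 1
  have key : (s : ℝ) * (ζ * u' 0 - u' 1) = t * symDet z *
      (ζ * ((symMat z' *ᵥ w) 0 : ℝ) - ((symMat z' *ᵥ w) 1 : ℝ)) := by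
    linear_combination ζ * e0 - e1
  refine le_of_mul_le_mul_left ?_ hs'
  rw [← abs_mul, key, abs_mul, abs_mul, exp_add (Γ + D), exp_add Γ D]
  calc |(t : ℝ)| * |(symDet z : ℝ)| * _ ≤ exp Γ * |(s : ℝ)| * exp D * exp (2 + E + M) := by
        gcongr
    _ = _ := by ring

theorem LateChain.descent (h : LateChain ζ δ K R a) (hθ : 0 < θ) (hθ' : θ ≤ 9 / 10)
    (hδθ : 1000 * δ ≤ θ) (hG : LinGood ζ (3 / 2 * θ)) : LinGood ζ θ := by
  obtain ⟨C, hC⟩ := hG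
  obtain ⟨Γ, hΓ, hΓe, hΓd⟩ := exists_exp_bound (transMat R 0)
  refine linGood_of_eventually (max (a 0 + a 1) (3 * (4 * Γ + 9 + |C|) / θ)) ?_
  intro q p hqp s hs hq hp
  have hs0 : a 0 + a (0 + 1) ≤ s := (le_max_left _ _).trans hs
  have hs1 := (le_max_right _ _).trans hs
  rw [div_le_iff₀ hθ] at hs1
  by_contra! hlt
  obtain ⟨k, hk, hk'⟩ := exists_le_and_lt_succ (b := fun k => a k + a (k + 1)) hs0 (by
    obtain ⟨k, hk⟩ := h.exists_lt s
    exact ⟨k, hk.trans (lt_add_of_pos_right _ (h.pos _))⟩)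
  replace hk' : s < a (k + 1) + a (k + 2) := hk'
  replace hk : a k + a (k + 1) ≤ s := hk
  set u : Fin 2 → ℤ := ![q, p] with hu
  have hu0 : u ≠ 0 := fun h0 => hqp ⟨congrFun h0 0, congrFun h0 1⟩
  have hue : |ζ * u 0 - u 1| ≤ exp (-((1 + θ) * s)) := hlt.le
  obtain ⟨σ, τ, G, hσ, hG, hτ, hne, e⟩ := h.exists_transfer k u hu0
  set v := δ * a k with hv
  have s1 := h.smul_le k
  have s2 : δ * a (k + 2) ≤ 7 / 4 * (δ * a (k + 1)) := h.smul_le (k + 1)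
  obtain ⟨f1, f1'⟩ := h.fib_bounds k
  obtain ⟨f2, f2'⟩ : a (k + 1) + a (k + 2) - δ * a (k + 1) ≤ a (k + 3) ∧
    a (k + 3) ≤ a (k + 1) + a (k + 2) + δ * a (k + 1) := h.fib_bounds (k + 1)
  have p0 := h.pos k
  have p1 := h.pos (k + 1)
  have p2 := h.pos (k + 2)
  have g0 := h.growth k
  have g0' := h.growth_le k
  have g1 : 3 / 2 * a (k + 1) ≤ a (k + 2) := h.growth (k + 1)
  have g1' : a (k + 2) ≤ 7 / 4 * a (k + 1) := h.growth_le (k + 1)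
  have g2 : 3 / 2 * a (k + 2) ≤ a (k + 3) := h.growth (k + 2)
  have q0 : 0 < v := mul_pos h.delta_pos p0
  rw [← hv] at *
  have hspos : 0 < s := by linarith
  have hθs : 0 < θ * s := mul_pos hθ hspos
  have hθs' : θ * s ≤ 9 / 10 * s := mul_le_mul_of_nonneg_right hθ' hspos.le
  have hθS : θ * s - θ * (a k + a (k + 1)) ≤ 3 / 7 * (θ * s) := by
    have : 4 / 7 * s ≤ a k + a (k + 1) := by linarith
    have := mul_le_mul_of_nonneg_left this hθ.le
    linarith
  have hvθ : 2500 * v ≤ θ * s := by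
    have h1 : 1000 * v ≤ θ * a k := by
      have := mul_le_mul_of_nonneg_right hδθ p0.le
      linarith
    have h2 : 5 / 2 * a k ≤ s := by linarith
    have := mul_le_mul_of_nonneg_left h2 hθ.le
    linarith
  have hw : ∀ i, |((adjMat (jumpVec R k) *ᵥ u) i : ℝ)| ≤
      2 * exp (s - (a k + a (k + 1)) + 2 * v) :=
    abs_adjMat_mulVec_le_exp (h.htLe_jumpVec k) (h.errLe_jumpVec k) hq hue
      (by linarith) (by linarith)
  have hGe : ∀ i j, |(G i j : ℝ)| ≤ exp Γ := by
    rcases hG with rfl | rfl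
    · exact hΓe
    · exact fun i j => hΓe j i
  have hu' : ∀ i, |((G *ᵥ (adjMat (jumpVec R k) *ᵥ u)) i : ℝ)| ≤
      exp (2 + Γ + (s - (a k + a (k + 1)) + 2 * v)) := fun i =>
    (abs_mulVec_le hGe hw i).trans (two_mul_exp_mul_two_mul_exp_le _ _)
  have hw2 : ∀ i, |((adjMat (jumpVec R (k + 2)) *ᵥ u) i : ℝ)| ≤
      2 * exp (a (k + 2) + a (k + 3) + 2 * (δ * a (k + 2)) - (1 + θ) * s) := by
    refine abs_adjMat_mulVec_le_exp (h.htLe_jumpVec (k + 2)) (h.errLe_jumpVec (k + 2)) hq hue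
      ?_ ?_
    · show s + (-(a (k + 2) + a (k + 3)) + 2 * (δ * a (k + 2))) ≤ _
      linarith
    · show a (k + 2) + a (k + 3) + 2 * (δ * a (k + 2)) + _ ≤ _
      linarith
  have hτ' : |(τ : ℝ)| ≤ exp Γ * |(σ : ℝ)| := by
    have : |(τ : ℝ)| ≤ |((transMat R 0).det : ℝ)| * |(σ : ℝ)| := by exact_mod_cast hτ
    exact this.trans (mul_le_mul_of_nonneg_right hΓd (abs_nonneg _))
  have hlin := abs_lin_transfer_le hσ hτ' (h.abs_symDet_jumpVec_le k)
    (h.errLe_jumpVec (k + 1)) hw2 e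
  have hne' : ¬((G *ᵥ (adjMat (jumpVec R k) *ᵥ u)) 0 = 0 ∧
      (G *ᵥ (adjMat (jumpVec R k) *ᵥ u)) 1 = 0) := by
    rintro ⟨h0, h1⟩
    apply hne
    ext i
    fin_cases i
    exacts [h0, h1]
  have hfin := exp_le_exp.mp ((hC _ _ hne' _ (hu' 0) (hu' 1)).trans hlin)
  have hC' := le_abs_self C
  have hΓθ : θ * Γ ≤ 9 / 10 * Γ := mul_le_mul_of_nonneg_right hθ' hΓ
  have hvθ' : θ * v ≤ 9 / 10 * v := mul_le_mul_of_nonneg_right hθ' q0.le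
  have hEq : -(a (k + 1) + a (k + 1 + 1)) = -(a (k + 1) + a (k + 2)) := rfl
  rw [hEq] at hfin
  linarith

theorem exists_lateChain (hT : QuadIndep ζ) (hU : ∀ η < (3 + √5) / 2, UnifExp ζ η)
    (hδ : 0 < δ) (hδ' : δ ≤ 1 / 1000) : ∃ K R a, LateChain ζ δ K R a := by
  obtain ⟨R, a, h⟩ := exists_fibChain hT hU hδ (20 * (1 + logC ζ) / δ)
  exact ⟨_, R, a, h, hδ, hδ', (mul_div_cancel₀ _ hδ.ne').ge⟩

theorem linGood_of_pos (hT : QuadIndep ζ) (hU : ∀ η < (3 + √5) / 2, UnifExp ζ η)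
    (hθ : 0 < θ) : LinGood ζ θ := by
  have key : ∀ n : ℕ, LinGood ζ (9 / 10 * (2 / 3) ^ n) := by
    intro n
    induction n with
    | zero =>
      rw [pow_zero, mul_one]
      refine linGood_nine_tenths hT (hU _ ?_)
      have : (11 / 5 : ℝ) < √5 := Real.lt_sqrt_of_sq_lt (by norm_num)
      linarith
    | succ n ih =>
      have hpos : (0 : ℝ) < (2 / 3) ^ (n + 1) := by positivity
      have hle : ((2 : ℝ) / 3) ^ (n + 1) ≤ 1 := pow_le_one₀ (by norm_num) (by norm_num)
      obtain ⟨K, R, a, h⟩ := exists_lateChain hT hU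
        (δ := 9 / 10 * (2 / 3) ^ (n + 1) / 1000) (by positivity) (by linarith)
      refine h.descent (by positivity) (by linarith) (by linarith) ?_
      convert ih using 1
      rw [pow_succ]; ring
  obtain ⟨n, hn⟩ := exists_pow_lt_of_lt_one hθ (by norm_num : (2 / 3 : ℝ) < 1)
  refine (key n).mono ?_
  have : (0 : ℝ) < (2 / 3) ^ n := by positivity
  linarith

end DescentStep

/-- The value at `ζ` of the cubic polynomial with coefficient vector `Q`. -/
def cubicVal (ζ : ℝ) (Q : Fin 4 → ℤ) : ℝ := Q 0 + Q 1 * ζ + Q 2 * ζ ^ 2 + Q 3 * ζ ^ 3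

/-- The determinant of the last three columns of three rows. -/
def minorDet (x y z : Fin 4 → ℤ) : ℤ :=
  x 1 * (y 2 * z 3 - y 3 * z 2) - x 2 * (y 1 * z 3 - y 3 * z 1) + x 3 * (y 1 * z 2 - y 2 * z 1)

/-- The determinant of four rows. -/
def rowDet (x y z w : Fin 4 → ℤ) : ℤ :=
  x 0 * minorDet y z w - y 0 * minorDet x z w + z 0 * minorDet x y w - w 0 * minorDet x y z

/-- The coefficients of a quadratic polynomial, seen as a cubic one. -/
def padVec (P : Fin 3 → ℤ) : Fin 4 → ℤ := ![P 0, P 1, P 2, 0]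

/-- The coefficients of `T` times a quadratic polynomial. -/
def shiftVec (P : Fin 3 → ℤ) : Fin 4 → ℤ := ![0, P 0, P 1, P 2]

section Resultant

open Real

variable {ζ : ℝ} {P P' : Fin 3 → ℤ} {Q x y z w : Fin 4 → ℤ}

theorem cubicVal_padVec : cubicVal ζ (padVec P) = quadVal ζ P := by
  simp [cubicVal, padVec, quadVal]

theorem cubicVal_shiftVec : cubicVal ζ (shiftVec P) = ζ * quadVal ζ P := by
  simp [cubicVal, shiftVec, quadVal]; ring

theorem abs_padVec_le {B : ℝ} (h : HtLe P B) (i : Fin 4) : |(padVec P i : ℝ)| ≤ B := by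
  have := h.nonneg
  fin_cases i <;> simp [padVec]
  exacts [h 0, h 1, h 2, this]

theorem abs_shiftVec_le {B : ℝ} (h : HtLe P B) (i : Fin 4) : |(shiftVec P i : ℝ)| ≤ B := by
  have := h.nonneg
  fin_cases i <;> simp [shiftVec]
  exacts [this, h 0, h 1, h 2]

theorem rowDet_eq (ζ : ℝ) : (rowDet x y z w : ℝ) = cubicVal ζ x * minorDet y z w
    - cubicVal ζ y * minorDet x z w + cubicVal ζ z * minorDet x y w
    - cubicVal ζ w * minorDet x y z := by
  simp only [rowDet, minorDet, cubicVal]; push_cast; ring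

theorem rowDet_pad_shift :
    rowDet (padVec P) (shiftVec P) (padVec P') (shiftVec P') = -symDet (crossVec P P') := by
  simp [rowDet, minorDet, padVec, shiftVec, symDet, crossVec]; ring

theorem cramer (i : Fin 4) : rowDet x y z w * Q i = rowDet Q y z w * x i + rowDet x Q z w * y i
    + rowDet x y Q w * z i + rowDet x y z Q * w i := by
  fin_cases i <;> simp only [rowDet, minorDet, Fin.zero_eta, Fin.mk_one, Fin.reduceFinMk] <;> ring

theorem abs_minorDet_le {a b c : ℝ} (hx : ∀ i, |(x i : ℝ)| ≤ exp a)
    (hy : ∀ i, |(y i : ℝ)| ≤ exp b) (hz : ∀ i, |(z i : ℝ)| ≤ exp c) :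
    |(minorDet x y z : ℝ)| ≤ 6 * exp (a + b + c) := by
  have h : ∀ i j, |(y i : ℝ) * z j - y j * z i| ≤ 2 * exp (b + c) := fun i j => by
    rw [exp_add, two_mul]
    exact abs_mul_sub_mul_le (hy _) (hz _) (hy _) (hz _)
  have h' : ∀ i j k, |(x i : ℝ) * ((y j : ℝ) * z k - y k * z j)| ≤ 2 * exp (a + b + c) := by
    intro i j k
    rw [abs_mul, add_assoc, exp_add a, mul_left_comm]
    exact mul_le_mul (hx i) (h j k) (abs_nonneg _) (exp_pos _).le
  have e1 := h' 1 2 3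
  have e2 := h' 2 1 3
  have e3 := h' 3 1 2
  rw [abs_le] at *
  simp only [minorDet]
  push_cast
  constructor <;> linarith

theorem abs_rowDet_le {a b c d α β γ κ X : ℝ} (hx : ∀ i, |(x i : ℝ)| ≤ exp a)
    (hy : ∀ i, |(y i : ℝ)| ≤ exp b) (hz : ∀ i, |(z i : ℝ)| ≤ exp c)
    (hw : ∀ i, |(w i : ℝ)| ≤ exp d) (vx : |cubicVal ζ x| ≤ exp α) (vy : |cubicVal ζ y| ≤ exp β)
    (vz : |cubicVal ζ z| ≤ exp γ) (vw : |cubicVal ζ w| ≤ exp κ) (h1 : α + (b + c + d) ≤ X)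
    (h2 : β + (a + c + d) ≤ X) (h3 : γ + (a + b + d) ≤ X) (h4 : κ + (a + b + c) ≤ X) :
    |(rowDet x y z w : ℝ)| ≤ exp (X + 5) := by
  have aux : ∀ {u v : ℝ} {p q : ℝ}, |u| ≤ exp p → |v| ≤ 6 * exp q → p + q ≤ X →
      |u * v| ≤ 6 * exp X := by
    intro u v p q hu hv hpq
    rw [abs_mul]
    calc |u| * |v| ≤ exp p * (6 * exp q) := by gcongr
      _ = 6 * exp (p + q) := by rw [exp_add]; ring
      _ ≤ _ := by gcongr
  have e1 := aux vx (abs_minorDet_le hy hz hw) h1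
  have e2 := aux vy (abs_minorDet_le hx hz hw) h2
  have e3 := aux vz (abs_minorDet_le hx hy hw) h3
  have e4 := aux vw (abs_minorDet_le hx hy hz) h4
  have h32 : (24 : ℝ) ≤ exp 5 := by
    have : exp 5 = exp 1 ^ 5 := by rw [← exp_nat_mul]; norm_num
    rw [this]
    calc (24 : ℝ) ≤ 2 ^ 5 := by norm_num
      _ ≤ _ := by gcongr; exact two_le_exp_one
  have h5 : 24 * exp X ≤ exp (X + 5) := by
    rw [exp_add, mul_comm]; gcongr
  rw [rowDet_eq ζ]
  rw [abs_le] at *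
  constructor <;> linarith

end Resultant

section Cubic

open Real

variable {ζ δ K ε : ℝ} {R : ℕ → Fin 3 → ℤ} {a : ℕ → ℝ}

theorem abs_cubicVal_padVec_le {P : Fin 3 → ℤ} {l : ℝ} (h : |quadVal ζ P| ≤ exp l) :
    |cubicVal ζ (padVec P)| ≤ exp l := by
  rwa [cubicVal_padVec]

theorem abs_cubicVal_shiftVec_le {P : Fin 3 → ℤ} {l : ℝ} (h : |quadVal ζ P| ≤ exp l) :
    |cubicVal ζ (shiftVec P)| ≤ exp (logC ζ + l) := by
  rw [cubicVal_shiftVec, abs_mul, exp_add, exp_logC]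
  gcongr
  linarith

theorem le_or_le_of_exp_le_add {r p q : ℝ} (h : exp r ≤ exp p + exp q) :
    r ≤ p + 1 ∨ r ≤ q + 1 := by
  by_contra! hc
  have h1 := exp_lt_exp.mpr hc.1
  have h2 := exp_lt_exp.mpr hc.2
  rw [exp_add] at h1 h2
  nlinarith [two_le_exp_one, exp_pos p, exp_pos q]

theorem LateChain.le_log_abs_quadVal (h : LateChain ζ δ K R a) (hT : QuadIndep ζ) (k : ℕ) :
    ∃ l : ℝ, |quadVal ζ (R k)| = exp l ∧ -(a k + 2 * a (k + 1) + δ * a k) ≤ l := by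
  have hR : R k ≠ 0 := by
    intro h0
    apply h.det k
    rw [h0]
    simp [symDet, crossVec]
  refine ⟨_, (exp_log (abs_pos.mpr (hT _ hR))).symm, ?_⟩
  set l := log |quadVal ζ (R k)| with hl
  have hle : |quadVal ζ (R k)| ≤ exp l := (exp_log (abs_pos.mpr (hT _ hR))).ge
  have hL := logC_nonneg ζ
  have c0 := h.const_le' k
  have p0 := h.pos k
  have g0 := h.growth k
  have g1 : 3 / 2 * a (k + 1) ≤ a (k + 2) := h.growth (k + 1)
  have m1 := h.small (k + 1)
  have m0 := h.small k
  have hne : rowDet (padVec (R k)) (shiftVec (R k)) (padVec (R (k + 1)))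
      (shiftVec (R (k + 1))) ≠ 0 := by
    rw [rowDet_pad_shift]
    exact neg_ne_zero.mpr (h.det k)
  by_contra! hlt
  have hb := abs_rowDet_le (X := -6) (abs_padVec_le (h.htLe k)) (abs_shiftVec_le (h.htLe k))
    (abs_padVec_le (h.htLe (k + 1))) (abs_shiftVec_le (h.htLe (k + 1)))
    (abs_cubicVal_padVec_le hle) (abs_cubicVal_shiftVec_le hle)
    (abs_cubicVal_padVec_le (h.val_le (k + 1))) (abs_cubicVal_shiftVec_le (h.val_le (k + 1)))
    (by linarith) (by linarith)
    (by show -(a (k + 1) + 2 * a (k + 2)) + δ * a (k + 1) + _ ≤ _; linarith)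
    (by show _ + (-(a (k + 1) + 2 * a (k + 2)) + δ * a (k + 1)) + _ ≤ _; linarith)
  have := (one_le_abs_intCast hne).trans hb
  rw [one_le_exp_iff] at this
  norm_num at this

set_option maxHeartbeats 400000 in
theorem LateChain.exists_smul_eq_mul (h : LateChain ζ (ε / 1000) K R a) (hT : QuadIndep ζ)
    (hε : 0 < ε) (hε' : ε ≤ 1) (hG : LinGood ζ (ε / 32)) :
    ∃ t₀ : ℝ, ∀ (Q : Fin 4 → ℤ) (t : ℝ), t₀ ≤ t → (∀ i, |(Q i : ℝ)| ≤ exp t) →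
      |cubicVal ζ Q| ≤ exp (-((3 + ε) * t)) → ∃ (D b₀ b₁ : ℤ) (P : Fin 3 → ℤ), D ≠ 0 ∧
        ∀ i, D * Q i = b₀ * padVec P i + b₁ * shiftVec P i := by
  obtain ⟨C, hC⟩ := hG
  refine ⟨max ((1 - ε / 8) * a 1) (20 * (|C| + 1) / ε), fun Q t ht hQ hQζ => ?_⟩
  have ht0 : (1 - ε / 8) * a (0 + 1) ≤ t := (le_max_left _ _).trans ht
  have ht1 := (le_max_right _ _).trans ht
  rw [div_le_iff₀ hε] at ht1
  obtain ⟨k, hk, hk'⟩ := exists_le_and_lt_succ (b := fun k => (1 - ε / 8) * a (k + 1)) ht0 (by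
    obtain ⟨k, hk⟩ := h.exists_lt (t / (1 - ε / 8))
    rw [div_lt_iff₀ (by linarith)] at hk
    refine ⟨k, hk.trans_le ?_⟩
    rw [mul_comm]
    exact mul_le_mul_of_nonneg_left (by linarith [h.pos k, h.growth k]) (by linarith))
  replace hk' : t < (1 - ε / 8) * a (k + 2) := hk'
  replace hk : (1 - ε / 8) * a (k + 1) ≤ t := hk
  have hL := logC_nonneg ζ
  have c0 := h.const_le' k
  have p0 := h.pos k
  have p1 := h.pos (k + 1)
  have g0 := h.growth k
  have g0' := h.growth_le k
  have g1 : 3 / 2 * a (k + 1) ≤ a (k + 2) := h.growth (k + 1)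
  have g1' : a (k + 2) ≤ 7 / 4 * a (k + 1) := h.growth_le (k + 1)
  have m1 := h.small (k + 1)
  have m0 := h.small k
  obtain ⟨f1, f1'⟩ := h.fib_bounds k
  obtain ⟨l, hl, hl'⟩ := h.le_log_abs_quadVal hT k
  have hv0 := h.val_le k
  have hv1 : |quadVal ζ (R (k + 1))| ≤
    exp (-(a (k + 1) + 2 * a (k + 2)) + ε / 1000 * a (k + 1)) := h.val_le (k + 1)
  have hD := h.abs_symDet_jumpVec_le k
  have hd0 : 0 < ε / 1000 * a k := mul_pos h.delta_pos p0
  have hd : ε / 1000 * a k ≤ ε / 1000 * a (k + 1) :=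
    mul_le_mul_of_nonneg_left (by linarith) h.delta_pos.le
  have hyε : 0 < ε * a (k + 1) := mul_pos hε p1
  have hyε' : ε * a (k + 1) ≤ a (k + 1) := mul_le_of_le_one_left p1.le hε'
  have hyz : ε * (3 / 2 * a (k + 1)) ≤ ε * a (k + 2) := mul_le_mul_of_nonneg_left g1 hε.le
  have hyz' : ε * a (k + 2) ≤ ε * (7 / 4 * a (k + 1)) := mul_le_mul_of_nonneg_left g1' hε.le
  have hεε : ε * (ε * a (k + 1)) ≤ ε * a (k + 1) := mul_le_of_le_one_left hyε.le hε'
  have htε : ε * ((1 - ε / 8) * a (k + 1)) ≤ ε * t := mul_le_mul_of_nonneg_left hk hε.le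
  have htz : ε * t ≤ ε * a (k + 2) := by
    apply mul_le_mul_of_nonneg_left _ hε.le
    linarith
  have hTP := abs_padVec_le (h.htLe k)
  have hTS := abs_shiftVec_le (h.htLe k)
  have hTP' := abs_padVec_le (h.htLe (k + 1))
  have hTS' := abs_shiftVec_le (h.htLe (k + 1))
  have hVP := abs_cubicVal_padVec_le hv0
  have hVS := abs_cubicVal_shiftVec_le hv0
  have hVP' := abs_cubicVal_padVec_le hv1
  have hVS' := abs_cubicVal_shiftVec_le hv1
  set d := ε / 1000 * a (k + 1) with hd_def
  have hdε : 1000 * d = ε * a (k + 1) := by rw [hd_def]; ring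
  set a₀ := rowDet Q (shiftVec (R k)) (padVec (R (k + 1))) (shiftVec (R (k + 1))) with ha₀
  set a₁ := rowDet (padVec (R k)) Q (padVec (R (k + 1))) (shiftVec (R (k + 1))) with ha₁
  set b₀ := rowDet (padVec (R k)) (shiftVec (R k)) Q (shiftVec (R (k + 1))) with hb₀
  set b₁ := rowDet (padVec (R k)) (shiftVec (R k)) (padVec (R (k + 1))) Q with hb₁
  have ha₀' : |(a₀ : ℝ)| ≤ exp (t - a k + 2 * d - 5 + 5) :=
    abs_rowDet_le hQ hTS hTP' hTS' hQζ hVS hVP' hVS'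
      (by linarith) (by linarith) (by linarith) (by linarith)
  have ha₁' : |(a₁ : ℝ)| ≤ exp (t - a k + 2 * d - 5 + 5) :=
    abs_rowDet_le hTP hQ hTP' hTS' hVP hQζ hVP' hVS'
      (by linarith) (by linarith) (by linarith) (by linarith)
  have hb₀' : |(b₀ : ℝ)| ≤ exp (t - a (k + 1) + 2 * d - 5 + 5) :=
    abs_rowDet_le hTP hTS hQ hTS' hVP hVS hQζ hVS'
      (by linarith) (by linarith) (by linarith) (by linarith)
  have hb₁' : |(b₁ : ℝ)| ≤ exp (t - a (k + 1) + 2 * d - 5 + 5) :=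
    abs_rowDet_le hTP hTS hTP' hQ hVP hVS hVP' hQζ
      (by linarith) (by linarith) (by linarith) (by linarith)
  rw [sub_add_cancel] at ha₀' ha₁' hb₀' hb₁'
  have hcr := fun i => cramer (x := padVec (R k)) (y := shiftVec (R k))
    (z := padVec (R (k + 1))) (w := shiftVec (R (k + 1))) (Q := Q) i
  rw [rowDet_pad_shift, ← ha₀, ← ha₁, ← hb₀, ← hb₁] at hcr
  by_cases hz : a₁ = 0 ∧ -a₀ = 0
  · refine ⟨_, b₀, b₁, R (k + 1), neg_ne_zero.mpr (h.det k), fun i => ?_⟩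
    rw [hcr, hz.1, neg_eq_zero.mp hz.2]
    ring
  exfalso
  have hlow := hC a₁ (-a₀) hz _ ha₁' (by rwa [Int.cast_neg, abs_neg])
  have hval : (ζ * a₁ - (-a₀ : ℤ)) * quadVal ζ (R k) =
      -((symDet (crossVec (R k) (R (k + 1))) : ℤ) : ℝ) * cubicVal ζ Q
        - (b₀ + b₁ * ζ) * quadVal ζ (R (k + 1)) := by
    have e : ∀ i, -((symDet (crossVec (R k) (R (k + 1))) : ℤ) : ℝ) * Q i =
        a₀ * padVec (R k) i + a₁ * shiftVec (R k) i + b₀ * padVec (R (k + 1)) i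
          + b₁ * shiftVec (R (k + 1)) i := fun i => by exact_mod_cast hcr i
    have e0 := cubicVal_padVec (ζ := ζ) (P := R k)
    have e1 := cubicVal_shiftVec (ζ := ζ) (P := R k)
    have e2 := cubicVal_padVec (ζ := ζ) (P := R (k + 1))
    have e3 := cubicVal_shiftVec (ζ := ζ) (P := R (k + 1))
    simp only [cubicVal] at e0 e1 e2 e3 ⊢
    push_cast
    linear_combination -e 0 - ζ * e 1 - ζ ^ 2 * e 2 - ζ ^ 3 * e 3 - a₀ * e0 - a₁ * e1
      - b₀ * e2 - b₁ * e3
  have hB : |(b₀ : ℝ) + b₁ * ζ| ≤ exp (logC ζ + (t - a (k + 1) + 2 * d)) := by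
    rw [exp_add, exp_logC]
    refine (abs_add_le _ _).trans ?_
    rw [abs_mul]
    linarith only [mul_le_mul_of_nonneg_right hb₁' (abs_nonneg ζ), hb₀',
      exp_pos (t - a (k + 1) + 2 * d)]
  have hup : |ζ * a₁ - (-a₀ : ℤ)| * exp l ≤
      exp (5 * (ε / 1000 * a k) + -((3 + ε) * t)) +
      exp (logC ζ + (t - a (k + 1) + 2 * d) + (-(a (k + 1) + 2 * a (k + 2)) + d)) := by
    rw [← hl, ← abs_mul, hval, exp_add (5 * _), exp_add (logC ζ + _)]
    refine (abs_sub _ _).trans ?_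
    rw [abs_mul, abs_mul, abs_neg]
    have hD' : |((symDet (crossVec (R k) (R (k + 1))) : ℤ) : ℝ)| ≤
      exp (5 * (ε / 1000 * a k)) := hD
    gcongr
  have hcomb := (mul_le_mul_of_nonneg_right hlow (exp_pos l).le).trans hup
  rw [← exp_add] at hcomb
  have hC' := le_abs_self C
  have hsm : ε * (t - a k + 2 * d) ≤ ε * (2 * a (k + 1)) := by
    apply mul_le_mul_of_nonneg_left _ hε.le
    linarith
  rcases le_or_le_of_exp_le_add hcomb with h1 | h1
  · linarith
  · linarith

end Cubic

section Polynomials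

open Polynomial

theorem abs_coeff_le_polyH (P : ℤ[X]) (i : ℕ) : |(P.coeff i : ℝ)| ≤ polyH P := by
  by_cases hi : i ∈ P.support
  · have h : (P.coeff i).natAbs ≤ P.support.sup fun i => (P.coeff i).natAbs :=
      Finset.le_sup (f := fun i => (P.coeff i).natAbs) hi
    rw [polyH, ← Int.cast_abs, Int.abs_eq_natAbs, Int.cast_natCast]
    exact_mod_cast h
  · rw [notMem_support_iff.mp hi, Int.cast_zero, abs_zero, polyH]
    positivity

theorem one_le_polyH {P : ℤ[X]} (hP : P ≠ 0) : 1 ≤ polyH P :=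
  (one_le_abs_intCast (leadingCoeff_ne_zero.mpr hP)).trans (abs_coeff_le_polyH P _)

theorem pev_eq_quadVal {ζ : ℝ} {P : ℤ[X]} (hP : P.natDegree ≤ 2) :
    pev ζ P = quadVal ζ fun i => P.coeff i := by
  rw [pev, aeval_eq_sum_range' (Nat.lt_succ_of_le hP)]
  simp [Finset.sum_range_succ, quadVal]

theorem pev_eq_cubicVal {ζ : ℝ} {P : ℤ[X]} (hP : P.natDegree ≤ 3) :
    pev ζ P = cubicVal ζ fun i => P.coeff i := by
  rw [pev, aeval_eq_sum_range' (Nat.lt_succ_of_le hP)]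
  simp [Finset.sum_range_succ, cubicVal]

theorem quadIndep_of_transcendental {ζ : ℝ} (h : Transcendental ℚ ζ) : QuadIndep ζ := by
  intro P hP h0
  refine hP ?_
  have hp : (C (P 0 : ℚ) + C (P 1 : ℚ) * X + C (P 2 : ℚ) * X ^ 2 : ℚ[X]) = 0 := by
    refine (transcendental_iff.mp h) _ ?_
    simpa [quadVal] using h0
  ext i
  have hc := fun n => congrArg (fun p : ℚ[X] => p.coeff n) hp
  fin_cases i
  · simpa [-map_intCast, -eq_intCast] using hc 0
  · simpa [coeff_X, coeff_C, -map_intCast, -eq_intCast] using hc 1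
  · simpa [coeff_X, coeff_C, -map_intCast, -eq_intCast] using hc 2

theorem unifExp_of_lt_whExp {ζ η : ℝ} (hpos : 0 < whExp 2 ζ) (hη : η < whExp 2 ζ) :
    UnifExp ζ η := by
  have hne : (whSet 2 ζ).Nonempty := by
    by_contra hne
    rw [Set.not_nonempty_iff_eq_empty] at hne
    rw [whExp, hne, Real.sSup_empty] at hpos
    exact lt_irrefl _ hpos
  obtain ⟨η', ⟨X₀, hX⟩, hlt⟩ := exists_lt_of_lt_csSup hne hη
  refine ⟨max 0 X₀, fun s hs => ?_⟩
  have hs0 : 0 ≤ s := (le_max_left _ _).trans hs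
  obtain ⟨P, hdeg, hH, hP0, hPle⟩ := hX (Real.exp s)
    (((le_max_right _ _).trans hs).trans (by linarith [Real.add_one_le_exp s]))
  refine ⟨fun i => P.coeff i, ?_, fun i => (abs_coeff_le_polyH P i).trans hH, ?_⟩
  · intro h0
    rw [pev_eq_quadVal hdeg, h0] at hP0
    simp [quadVal] at hP0
  · rw [← pev_eq_quadVal hdeg]
    refine hPle.trans ?_
    rw [← Real.exp_mul]
    apply Real.exp_le_exp.mpr
    nlinarith

theorem natDegree_lt_three_of_dvd {P A B : ℤ[X]} {D : ℤ} (hP : Irreducible P) (hD : D ≠ 0)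
    (hA : A.natDegree ≤ 2) (hB : B.natDegree ≤ 2) (h : C D * P = A * B) : P.natDegree < 3 := by
  have hAB : A * B ≠ 0 := h ▸ mul_ne_zero (C_ne_zero.mpr hD) hP.ne_zero
  rcases hP.prime.dvd_or_dvd (h ▸ dvd_mul_left P (C D)) with hd | hd
  · exact (natDegree_le_of_dvd hd (left_ne_zero_of_mul hAB)).trans_lt (by omega)
  · exact (natDegree_le_of_dvd hd (right_ne_zero_of_mul hAB)).trans_lt (by omega)

theorem natDegree_lt_three_of_smul_eq {Q : ℤ[X]} {D b₀ b₁ : ℤ} {P : Fin 3 → ℤ}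
    (hQ : Irreducible Q) (hdeg : Q.natDegree ≤ 3) (hD : D ≠ 0)
    (h : ∀ i : Fin 4, D * Q.coeff i = b₀ * padVec P i + b₁ * shiftVec P i) :
    Q.natDegree < 3 := by
  refine natDegree_lt_three_of_dvd (A := C b₁ * X + C b₀)
    (B := C (P 2) * X ^ 2 + C (P 1) * X + C (P 0)) hQ hD
    (natDegree_linear_le.trans one_le_two) natDegree_quadratic_le ?_
  have hQe := Q.as_sum_range' 4 (by omega)
  have e0 := congrArg (C : ℤ → ℤ[X]) (h 0)
  have e1 := congrArg (C : ℤ → ℤ[X]) (h 1)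
  have e2 := congrArg (C : ℤ → ℤ[X]) (h 2)
  have e3 := congrArg (C : ℤ → ℤ[X]) (h 3)
  simp [padVec, shiftVec] at e0 e1 e2 e3
  simp only [Finset.sum_range_succ, Finset.range_zero, Finset.sum_empty,
    ← C_mul_X_pow_eq_monomial] at hQe
  rw [hQe]
  simp only [eq_intCast] at *
  linear_combination e0 + X * e1 + X ^ 2 * e2 + X ^ 3 * e3

theorem finite_of_coeff_bounded (n : ℕ) (B : ℝ) :
    {Q : ℤ[X] | Q.natDegree ≤ n ∧ ∀ i, |(Q.coeff i : ℝ)| ≤ B}.Finite := by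
  refine Set.Finite.of_finite_image (f := fun Q : ℤ[X] => fun i : Fin (n + 1) => Q.coeff i)
    ((Set.finite_Icc (fun _ : Fin (n + 1) => -⌈B⌉) fun _ => ⌈B⌉).subset ?_) ?_
  · rintro _ ⟨Q, ⟨_, hQ⟩, rfl⟩
    have hb : ∀ i, |Q.coeff i| ≤ ⌈B⌉ := fun i => by exact_mod_cast (hQ i).trans (Int.le_ceil B)
    exact ⟨fun i => (abs_le.mp (hb i)).1, fun i => (abs_le.mp (hb i)).2⟩
  · rintro P ⟨hP, _⟩ Q ⟨hQ, _⟩ h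
    ext i
    by_cases hi : i < n + 1
    · exact congrFun h ⟨i, hi⟩
    · rw [coeff_eq_zero_of_natDegree_lt (by omega), coeff_eq_zero_of_natDegree_lt (by omega)]

end Polynomials

theorem extremal_cubic_finite (ζ : ℝ) (hζ : IsExtremal ζ) (ε : ℝ) (hε : 0 < ε) :
    {Q : Polynomial ℤ | Irreducible Q ∧ Q.natDegree = 3 ∧
      |pev ζ Q| ≤ polyH Q ^ (-3 - ε)}.Finite := by
  have hT := quadIndep_of_transcendental hζ.1
  have hU : ∀ η < (3 + √5) / 2, UnifExp ζ η := fun η hη =>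
    unifExp_of_lt_whExp (hζ.2 ▸ by positivity) (hζ.2 ▸ hη)
  set ε' := min ε 1 with hε'
  have hpos : 0 < ε' := lt_min hε one_pos
  have hle : ε' ≤ 1 := min_le_right _ _
  obtain ⟨K, R, a, h⟩ := exists_lateChain hT hU (δ := ε' / 1000) (by positivity) (by linarith)
  obtain ⟨t₀, ht⟩ := h.exists_smul_eq_mul hT hpos hle (linGood_of_pos hT hU (by positivity))
  refine (finite_of_coeff_bounded 3 (Real.exp t₀)).subset ?_
  rintro Q ⟨hirr, hdeg, hval⟩
  refine ⟨hdeg.le, fun i => (abs_coeff_le_polyH Q i).trans ?_⟩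
  by_contra! hlt
  have hH := one_le_polyH hirr.ne_zero
  have hexp := Real.exp_log (one_pos.trans_le hH)
  set t := Real.log (polyH Q) with ht_def
  have ht0 : 0 ≤ t := Real.log_nonneg hH
  have htt : t₀ ≤ t := by
    rw [← hexp] at hlt
    exact (Real.exp_lt_exp.mp hlt).le
  obtain ⟨D, b₀, b₁, P, hD, hDQ⟩ := ht (fun i => Q.coeff i) t htt
    (fun i => hexp ▸ abs_coeff_le_polyH Q i) (by
      rw [← pev_eq_cubicVal hdeg.le]
      refine hval.trans ?_
      rw [← hexp, ← Real.exp_mul]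
      apply Real.exp_le_exp.mpr
      nlinarith [min_le_left ε 1])
  exact (natDegree_lt_three_of_smul_eq hirr hdeg.le hD hDQ).ne hdeg
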